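/- arXiv:2104.11945 — 7 statements merged into one kernel-verified Lean document; each statement's English description precedes it below -/
import Mathlib

section
/- The invariant subalgebra R^{Σ_n} is generated as a k-algebra by the elements c_{s,i} for integers s, i ≥ 0 with 1 ≤ s + i ≤ n. -/
open MvPolynomial

noncomputable section

variable (k : Type) [CommRing k] (n : ℕ)

/-- The set of relations `u_i ^ 2 - u_i`, where `u_i = X (Sum.inr i)` and `w_i = X (Sum.inl i)`. -/
def relSet : Set (MvPolynomial (Fin n ⊕ Fin n) k) :=
  Set.range fun i : Fin n => X (Sum.inr i) ^ 2 - X (Sum.inr i)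

/-- The ring `R = k[w_1,…,w_n,u_1,…,u_n]/(u_i² − u_i)`. -/
abbrev RR := MvPolynomial (Fin n ⊕ Fin n) k ⧸ Ideal.span (relSet k n)

/-- The action of a permutation `σ ∈ Σ_n` on `R`, permuting the `w_i` and `u_i` separately. -/
def permAut (σ : Equiv.Perm (Fin n)) : RR k n →ₐ[k] RR k n :=
  Ideal.Quotient.liftₐ (Ideal.span (relSet k n))
    ((Ideal.Quotient.mkₐ k (Ideal.span (relSet k n))).comp (rename (Sum.map σ σ)))
    (by
      intro a ha
      have hmem : rename (Sum.map σ σ) a ∈ Ideal.span (relSet k n) := by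
        have hmap : Ideal.map ((rename (Sum.map ⇑σ ⇑σ) : MvPolynomial (Fin n ⊕ Fin n) k →ₐ[k] MvPolynomial (Fin n ⊕ Fin n) k) : MvPolynomial (Fin n ⊕ Fin n) k →+* MvPolynomial (Fin n ⊕ Fin n) k)
            (Ideal.span (relSet k n)) ≤ Ideal.span (relSet k n) := by
          rw [Ideal.map_span, Ideal.span_le]
          rintro x ⟨p, ⟨i, rfl⟩, rfl⟩
          refine Ideal.subset_span ?_
          refine ⟨σ i, ?_⟩
          simp [map_sub, map_pow, rename_X]
        exact hmap (Ideal.mem_map_of_mem _ ha)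
      simp only [AlgHom.comp_apply, Ideal.Quotient.mkₐ_eq_mk]
      rw [Ideal.Quotient.eq_zero_iff_mem]
      exact hmem)

/-- The invariant subalgebra `R^{Σ_n}`. -/
def invariants : Subalgebra k (RR k n) where
  carrier := {x | ∀ σ : Equiv.Perm (Fin n), permAut k n σ x = x}
  mul_mem' := fun hx hy σ => by rw [map_mul, hx σ, hy σ]
  one_mem' := fun σ => map_one _
  add_mem' := fun hx hy σ => by rw [map_add, hx σ, hy σ]
  zero_mem' := fun σ => map_zero _
  algebraMap_mem' := fun r σ => AlgHom.commutes _ r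

/-- The polynomial `C_{s,i}`: the sum over all pairs of disjoint subsets
`{m_1<⋯<m_s}`, `{l_1<⋯<l_i}` of `{1,…,n}` of `w_{m_1}⋯w_{m_s}·u_{l_1}⋯u_{l_i}`. -/
def Cpoly (s i : ℕ) : MvPolynomial (Fin n ⊕ Fin n) k :=
  ∑ p ∈ Finset.univ.filter
      (fun p : Finset (Fin n) × Finset (Fin n) =>
        p.1.card = s ∧ p.2.card = i ∧ Disjoint p.1 p.2),
    (∏ m ∈ p.1, X (Sum.inl m)) * ∏ l ∈ p.2, X (Sum.inr l)

/-- The element `c_{s,i} ∈ R`. -/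
def cElt (s i : ℕ) : RR k n := Ideal.Quotient.mk _ (Cpoly k n s i)

theorem sum_inl {K : Type} [CommRing K] {α β : Type} (σ : Equiv.Perm α) (f : MvPolynomial (α ⊕ β) K) :
    sumAlgEquiv K α β (rename (Sum.map σ id) f) = rename σ (sumAlgEquiv K α β f) := by
  induction f using MvPolynomial.induction_on with
  | C a => simp
  | add p q hp hq => simp only [map_add, hp, hq]
  | mul_X p i hp =>
    rcases i with i | i <;> simp only [map_mul, hp, rename_X, Sum.map_inl, Sum.map_inr,
      sumAlgEquiv_X_inl, sumAlgEquiv_X_inr, rename_C, id]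

theorem sum_inr {K : Type} [CommRing K] {α β : Type} (τ : Equiv.Perm β) (f : MvPolynomial (α ⊕ β) K) :
    sumAlgEquiv K α β (rename (Sum.map id τ) f)
      = map (rename τ : MvPolynomial β K →ₐ[K] MvPolynomial β K).toRingHom (sumAlgEquiv K α β f) := by
  induction f using MvPolynomial.induction_on with
  | C a => simp
  | add p q hp hq => simp only [map_add, hp, hq]
  | mul_X p i hp =>
    rcases i with i | i <;> simp [map_mul, hp]

theorem sym_mem {K : Type} [CommRing K] {β : Type} [Fintype β] (f : MvPolynomial β K)
    (hf : f.IsSymmetric) : f ∈ Algebra.adjoin K (Set.range (esymm β K)) := by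
  obtain ⟨q, hq⟩ := esymmAlgHom_surjective (σ := β) K (n := Fintype.card β) le_rfl ⟨f, hf⟩
  have := congrArg Subtype.val hq
  rw [esymmAlgHom_apply] at this
  simp only at this
  rw [← this]
  have h3 : Algebra.adjoin K (Set.range (fun i : Fin (Fintype.card β) ↦ esymm β K (i + 1)))
      ≤ Algebra.adjoin K (Set.range (esymm β K)) :=
    Algebra.adjoin_mono (by rintro _ ⟨i, rfl⟩; exact ⟨_, rfl⟩)
  apply h3
  rw [Algebra.adjoin_range_eq_range_aeval]
  exact ⟨q, rfl⟩

theorem ft_sum {K : Type} [CommRing K] {α β : Type} [Fintype α] [Fintype β]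
    (f : MvPolynomial (α ⊕ β) K)
    (h1 : ∀ σ : Equiv.Perm α, rename (Sum.map σ id) f = f)
    (h2 : ∀ σ : Equiv.Perm β, rename (Sum.map id σ) f = f) :
    f ∈ Algebra.adjoin K (Set.range (fun p => rename Sum.inl (esymm α K p)) ∪
      Set.range (fun p => rename Sum.inr (esymm β K p))) := by
  set S := Algebra.adjoin K (Set.range (fun p => rename Sum.inl (esymm α K p)) ∪
      Set.range (fun p => rename Sum.inr (esymm β K p))) with hS
  have key : ∀ r : MvPolynomial β K, r.IsSymmetric →
      (rename Sum.inr r : MvPolynomial (α ⊕ β) K) ∈ S := by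
    intro r hr
    have : Algebra.adjoin K (Set.range (esymm β K)) ≤ S.comap (rename Sum.inr) := by
      rw [Algebra.adjoin_le_iff]
      rintro _ ⟨p, rfl⟩
      exact Algebra.subset_adjoin (Or.inr ⟨p, rfl⟩)
    exact this (sym_mem r hr)
  have hg : (sumAlgEquiv K α β f).IsSymmetric := fun σ => by rw [← sum_inl, h1]
  obtain ⟨h, hh⟩ := esymmAlgHom_surjective (σ := α) (MvPolynomial β K) (n := Fintype.card α) le_rfl ⟨_, hg⟩
  have hh' := congrArg Subtype.val hh
  rw [esymmAlgHom_apply] at hh'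
  simp only at hh'
  have inj : Function.Injective (aeval (R := MvPolynomial β K) (fun i : Fin (Fintype.card α) ↦ esymm α (MvPolynomial β K) (i + 1))) := by
    intro a b hab
    apply esymmAlgHom_injective (σ := α) (MvPolynomial β K) (n := Fintype.card α) le_rfl
    apply Subtype.ext
    rw [esymmAlgHom_apply, esymmAlgHom_apply, hab]
  have hco : ∀ t, (coeff t h).IsSymmetric := by
    intro t τ
    have : map (rename τ : MvPolynomial β K →ₐ[K] MvPolynomial β K).toRingHom h = h := by
      apply inj
      rw [hh']
      conv_rhs => rw [← h2 τ, sum_inr, ← hh']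
      generalize (rename τ : MvPolynomial β K →ₐ[K] MvPolynomial β K).toRingHom = φ
      clear hh' hh inj
      induction h using MvPolynomial.induction_on with
      | C a => simp
      | add p q hp hq => simp only [map_add, hp, hq]
      | mul_X p i hp => simp only [map_mul, hp, map_X, aeval_X, map_esymm]
    conv_rhs => rw [← this, coeff_map]
    rfl
  have : f = (sumAlgEquiv K α β).symm (sumAlgEquiv K α β f) := by simp
  rw [this, ← hh', h.as_sum, map_sum, map_sum]
  refine Subalgebra.sum_mem _ fun t _ => ?_
  rw [aeval_monomial, map_mul, Finsupp.prod, map_prod]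
  refine Subalgebra.mul_mem _ ?_ (Subalgebra.prod_mem _ fun i _ => ?_)
  · convert key _ (hco t) using 1
    rw [AlgEquiv.symm_apply_eq]
    exact (AlgHom.congr_fun (sumAlgEquiv_comp_rename_inr K α β) _).symm
  · rw [map_pow]
    apply Subalgebra.pow_mem
    apply Algebra.subset_adjoin
    refine Or.inl ⟨i+1, ?_⟩
    simp [esymm, map_sum, map_prod]

/-- Evaluation at the characteristic function of `A`. -/
def phi (A : Finset (Fin n)) : RR k n →ₐ[k] MvPolynomial (Fin n) k :=
  Ideal.Quotient.liftₐ (Ideal.span (relSet k n))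
    (aeval (Sum.elim X (fun j => if j ∈ A then 1 else 0)))
    (by
      intro a ha
      have h : Ideal.span (relSet k n) ≤ RingHom.ker (aeval (R := k) (Sum.elim X
          (fun j => if j ∈ A then (1 : MvPolynomial (Fin n) k) else 0))) := by
        rw [Ideal.span_le]
        rintro _ ⟨i, rfl⟩
        simp [RingHom.mem_ker]
      exact h ha)

/-- The class of the variable. -/
def wE (j : Fin n) : RR k n := Ideal.Quotient.mk _ (X (Sum.inl j))
/-- The class of the variable. -/
def uE (j : Fin n) : RR k n := Ideal.Quotient.mk _ (X (Sum.inr j))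

theorem RR_ind {P : RR k n → Prop} (hC : ∀ a : k, P (algebraMap k _ a))
    (hadd : ∀ x y, P x → P y → P (x + y)) (hw : ∀ x j, P x → P (x * wE k n j))
    (hu : ∀ x j, P x → P (x * uE k n j)) (x : RR k n) : P x := by
  obtain ⟨f, rfl⟩ := Ideal.Quotient.mk_surjective x
  induction f using MvPolynomial.induction_on with
  | C a => exact hC a
  | add p q hp hq => rw [map_add]; exact hadd _ _ hp hq
  | mul_X p i hp =>
    rw [map_mul]
    rcases i with i | i
    · exact hw _ _ hp
    · exact hu _ _ hp

theorem uE_sq (j : Fin n) : uE k n j * uE k n j = uE k n j := by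
  unfold uE
  rw [← map_mul, Ideal.Quotient.eq, ← pow_two]
  exact Ideal.subset_span ⟨j, rfl⟩

theorem phi_w (A : Finset (Fin n)) (j) : phi k n A (wE k n j) = X j := by
  unfold phi wE
  erw [Ideal.Quotient.liftₐ_apply]
  simp

theorem phi_u (A : Finset (Fin n)) (j) : phi k n A (uE k n j) = if j ∈ A then 1 else 0 := by
  unfold phi uE
  erw [Ideal.Quotient.liftₐ_apply]
  simp

theorem perm_w (σ : Equiv.Perm (Fin n)) (j) : permAut k n σ (wE k n j) = wE k n (σ j) := by
  have h : permAut k n σ (wE k n j)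
      = Ideal.Quotient.mk _ (rename (Sum.map σ σ) (X (Sum.inl j))) := rfl
  rw [h, rename_X]
  rfl

theorem perm_u (σ : Equiv.Perm (Fin n)) (j) : permAut k n σ (uE k n j) = uE k n (σ j) := by
  have h : permAut k n σ (uE k n j)
      = Ideal.Quotient.mk _ (rename (Sum.map σ σ) (X (Sum.inr j))) := rfl
  rw [h, rename_X]
  rfl

theorem phi_perm (σ : Equiv.Perm (Fin n)) (A : Finset (Fin n)) (x : RR k n) :
    phi k n (A.map σ.toEmbedding) (permAut k n σ x) = rename σ (phi k n A x) := by
  induction x using RR_ind with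
  | hC a => simp only [AlgHom.commutes]
  | hadd x y hx hy => simp only [map_add, hx, hy]
  | hw x j hx => simp only [map_mul, hx, perm_w, phi_w, rename_X]
  | hu x j hx =>
    simp only [map_mul, hx, perm_u, phi_u]
    by_cases h : j ∈ A <;> simp [h]

/-- The idempotent of `A`. -/
def eps (A : Finset (Fin n)) : RR k n := (∏ j ∈ A, uE k n j) * ∏ j ∈ Finset.univ \ A, (1 - uE k n j)

theorem sum_eps : ∑ A, eps k n A = 1 := by
  have := Finset.prod_add (fun j => uE k n j) (fun j => 1 - uE k n j) Finset.univ
  simp only [add_sub_cancel, Finset.prod_const_one, Finset.powerset_univ] at this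
  exact this.symm

theorem eps_u (A : Finset (Fin n)) (j) : eps k n A * uE k n j = if j ∈ A then eps k n A else 0 := by
  unfold eps
  split_ifs with h
  · rw [← Finset.mul_prod_erase _ _ h]
    linear_combination (∏ j ∈ A.erase j, uE k n j) * (∏ j ∈ Finset.univ \ A, (1 - uE k n j)) * uE_sq k n j
  · have h' : j ∈ Finset.univ \ A := by simp [h]
    rw [← Finset.mul_prod_erase _ _ h']
    linear_combination -(∏ j ∈ A, uE k n j) * (∏ j ∈ (Finset.univ \ A).erase j, (1 - uE k n j)) * uE_sq k n j

theorem eps_mul (A : Finset (Fin n)) (x : RR k n) :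
    eps k n A * x = eps k n A * aeval (wE k n) (phi k n A x) := by
  induction x using RR_ind with
  | hC a => rw [AlgHom.commutes, AlgHom.commutes]
  | hadd x y hx hy => simp only [map_add, mul_add, hx, hy]
  | hw x j hx => rw [map_mul, map_mul, phi_w, aeval_X, ← mul_assoc, ← mul_assoc, hx]
  | hu x j hx =>
    rw [map_mul, map_mul, phi_u, mul_comm x, ← mul_assoc, eps_u]
    split_ifs <;> simp [hx]

theorem phi_ext {x y : RR k n} (h : ∀ A, phi k n A x = phi k n A y) : x = y := by
  rw [← one_mul x, ← one_mul y, ← sum_eps, Finset.sum_mul, Finset.sum_mul]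
  exact Finset.sum_congr rfl fun A _ => by rw [eps_mul, h, ← eps_mul]

theorem cElt_eq (s i : ℕ) : cElt k n s i = ∑ S ∈ Finset.powersetCard s Finset.univ,
    (∏ m ∈ S, wE k n m) * ∑ L ∈ Finset.powersetCard i (Finset.univ \ S), ∏ l ∈ L, uE k n l := by
  unfold cElt Cpoly
  simp only [Finset.mul_sum]
  rw [map_sum, Finset.sum_sigma']
  refine Finset.sum_bij' (fun p _ => ⟨p.1, p.2⟩) (fun p _ => (p.1, p.2)) ?_ ?_ ?_ ?_ ?_
  · rintro ⟨S, L⟩ h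
    simp only [Finset.mem_filter, Finset.mem_univ, true_and] at h
    simp only [Finset.mem_sigma, Finset.mem_powersetCard, Finset.subset_univ, true_and]
    refine ⟨h.1, ?_, h.2.1⟩
    intro j hj
    simpa using fun h' => Finset.disjoint_left.1 h.2.2 h' hj
  · rintro ⟨S, L⟩ h
    simp only [Finset.mem_sigma, Finset.mem_powersetCard, Finset.subset_univ, true_and] at h
    simp only [Finset.mem_filter, Finset.mem_univ, true_and]
    refine ⟨h.1, h.2.2, Finset.disjoint_left.2 fun j hj hj' => ?_⟩
    have := h.2.1 hj'
    simp [hj] at this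
  · intros; rfl
  · intros; rfl
  · intros; simp [wE, uE, map_prod]

theorem phi_c (A : Finset (Fin n)) (s i : ℕ) :
    phi k n A (cElt k n s i) = ∑ S ∈ Finset.powersetCard s Finset.univ,
      ((A \ S).card.choose i : MvPolynomial (Fin n) k) * ∏ m ∈ S, X m := by
  rw [cElt_eq, map_sum]
  refine Finset.sum_congr rfl fun S _ => ?_
  rw [map_mul, map_prod, mul_comm, map_sum]
  simp only [phi_w, map_prod, phi_u]
  congr 1
  have : ∀ L : Finset (Fin n), (∏ l ∈ L, if l ∈ A then (1 : MvPolynomial (Fin n) k) else 0)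
      = if L ⊆ A then 1 else 0 := by
    intro L
    rw [Finset.prod_ite_zero]
    simp [Finset.subset_iff]
  simp only [this]
  rw [← Finset.sum_filter, Finset.sum_const, nsmul_one, ← Finset.card_powersetCard]
  congr 2
  ext L
  simp only [Finset.mem_filter, Finset.mem_powersetCard, Finset.subset_iff, Finset.mem_sdiff, Finset.mem_univ, true_and]
  grind

theorem c_inv (σ : Equiv.Perm (Fin n)) (s i : ℕ) : permAut k n σ (cElt k n s i) = cElt k n s i := by
  apply phi_ext
  intro A
  obtain ⟨B, rfl⟩ : ∃ B : Finset (Fin n), A = B.map σ.toEmbedding :=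
    ⟨A.map σ.symm.toEmbedding, by ext; simp⟩
  rw [phi_perm, phi_c, phi_c, map_sum]
  refine Finset.sum_bij' (fun S _ => S.map σ.toEmbedding) (fun S _ => S.map σ.symm.toEmbedding) ?_ ?_ ?_ ?_ ?_
  · intro S hS; simpa using hS
  · intro S hS; simpa using hS
  · intro S hS; ext; simp
  · intro S hS; ext; simp
  · intro S hS
    rw [← Finset.map_sdiff, Finset.card_map]
    simp

/-- The algebra generated by the `c`. -/
def adC : Subalgebra k (RR k n) :=
  Algebra.adjoin k {x : RR k n | ∃ s i : ℕ, 1 ≤ s + i ∧ s + i ≤ n ∧ x = cElt k n s i}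

theorem c_mem (s i : ℕ) : cElt k n s i ∈ adC k n := by
  by_cases h : 1 ≤ s + i
  · by_cases h' : s + i ≤ n
    · exact Algebra.subset_adjoin ⟨s, i, h, h', rfl⟩
    · have : cElt k n s i = 0 := by
        rw [cElt_eq]
        refine Finset.sum_eq_zero fun S hS => ?_
        rw [Finset.powersetCard_eq_empty.2, Finset.sum_empty, mul_zero]
        rw [Finset.mem_powersetCard] at hS
        have := Finset.card_sdiff_add_card_eq_card (Finset.subset_univ S)
        simp only [Finset.card_univ, Fintype.card_fin] at this
        omega
      rw [this]; exact Subalgebra.zero_mem _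
  · obtain ⟨rfl, rfl⟩ : s = 0 ∧ i = 0 := by omega
    have : cElt k n 0 0 = 1 := by rw [cElt_eq]; simp
    rw [this]; exact Subalgebra.one_mem _

/-- The coefficients of binomial inversion. -/
def co (m l : ℕ) : ℤ := (fwdDiff (1 : ℕ))^[l] (fun N : ℕ => if N = m then (1 : ℤ) else 0) 0

theorem co_sum (m N : ℕ) (hN : N ≤ n) :
    ∑ l ∈ Finset.range (n + 1), (N.choose l : ℤ) * co m l = if N = m then 1 else 0 := by
  have := shift_eq_sum_fwdDiff_iter (1 : ℕ) (fun N : ℕ => if N = m then (1 : ℤ) else 0) N 0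
  simp only [smul_eq_mul, mul_one, zero_add] at this
  rw [this]
  symm
  simp only [nsmul_eq_mul]
  refine Finset.sum_subset (by intro x; simp; omega) ?_
  intro l _ hl
  rw [Nat.choose_eq_zero_of_lt (by simpa using hl)]
  simp

/-- The elements `D`. -/
def DD (s m : ℕ) : RR k n := ∑ l ∈ Finset.range (n + 1), (co m l : RR k n) * cElt k n s l

theorem DD_mem (s m : ℕ) : DD k n s m ∈ adC k n :=
  Subalgebra.sum_mem _ fun _ _ => Subalgebra.mul_mem _ (intCast_mem _ _) (c_mem k n _ _)

theorem phi_D (A : Finset (Fin n)) (s m : ℕ) :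
    phi k n A (DD k n s m) = ∑ S ∈ Finset.powersetCard s Finset.univ with (A \ S).card = m,
      ∏ j ∈ S, X j := by
  unfold DD
  rw [map_sum]
  simp only [map_mul, map_intCast, phi_c, Finset.mul_sum]
  rw [Finset.sum_comm, Finset.sum_filter]
  refine Finset.sum_congr rfl fun S _ => ?_
  have := congrArg (fun z : ℤ => (z : MvPolynomial (Fin n) k) * ∏ j ∈ S, X j)
    (co_sum n m (A \ S).card (by simpa using Finset.card_le_univ (A \ S)))
  simp only [Int.cast_sum, Int.cast_mul, Int.cast_natCast, Finset.sum_mul] at this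
  refine Eq.trans (Finset.sum_congr rfl fun l _ => ?_) (this.trans ?_)
  · ring
  · split_ifs <;> simp

theorem phi_D1 (A : Finset (Fin n)) (p : ℕ) (hp : p ≤ A.card) :
    phi k n A (DD k n p (A.card - p)) = ∑ S ∈ Finset.powersetCard p A, ∏ j ∈ S, X j := by
  rw [phi_D]
  refine Finset.sum_congr ?_ fun _ _ => rfl
  ext S
  simp only [Finset.mem_filter, Finset.mem_powersetCard, Finset.subset_univ, true_and]
  have h1 := Finset.card_sdiff_add_card_inter A S
  constructor
  · rintro ⟨h2, h3⟩
    refine ⟨?_, h2⟩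
    have : A ∩ S = S := Finset.eq_of_subset_of_card_le Finset.inter_subset_right (by omega)
    rw [← this]; exact Finset.inter_subset_left
  · rintro ⟨h2, h3⟩
    rw [Finset.inter_eq_right.2 h2] at h1
    omega

theorem phi_D2 (A : Finset (Fin n)) (p : ℕ) :
    phi k n A (DD k n p A.card) = ∑ S ∈ Finset.powersetCard p Aᶜ, ∏ j ∈ S, X j := by
  rw [phi_D]
  refine Finset.sum_congr ?_ fun _ _ => rfl
  ext S
  simp only [Finset.mem_filter, Finset.mem_powersetCard, Finset.subset_univ, true_and]
  have h1 := Finset.card_sdiff_add_card_inter A S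
  have h2 : S ⊆ Aᶜ ↔ (A ∩ S).card = 0 := by
    rw [Finset.card_eq_zero, ← Finset.disjoint_iff_inter_eq_empty, Finset.subset_compl_iff_disjoint_left]
  rw [h2]
  omega

theorem phi_D0 (A : Finset (Fin n)) (a : ℕ) :
    phi k n A (DD k n 0 a) = if A.card = a then 1 else 0 := by
  rw [phi_D]
  simp [Finset.sum_filter]

theorem esymm_sub (p : Fin n → Prop) [DecidablePred p] [Fintype {j // p j}] (q : ℕ) :
    rename Subtype.val (esymm {j // p j} k q) =
      ∑ S ∈ Finset.powersetCard q (Finset.univ.filter p), ∏ j ∈ S, (X j : MvPolynomial (Fin n) k) := by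
  have h : Finset.univ.filter p = (Finset.univ : Finset {j // p j}).map (Function.Embedding.subtype p) := by
    ext; simp
  rw [h, Finset.powersetCard_map, Finset.sum_map]
  simp [esymm, map_sum, map_prod]

theorem ft_A (A : Finset (Fin n)) (f : MvPolynomial (Fin n) k)
    (hf : ∀ σ : Equiv.Perm (Fin n), A.map σ.toEmbedding = A → rename σ f = f) :
    f ∈ Algebra.adjoin k (Set.range (fun p => ∑ S ∈ Finset.powersetCard p A, ∏ j ∈ S, (X j : MvPolynomial (Fin n) k)) ∪
      Set.range (fun p => ∑ S ∈ Finset.powersetCard p Aᶜ, ∏ j ∈ S, X j)) := by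
  let e := Equiv.sumCompl (fun j => j ∈ A)
  have hs : ∀ (σ : Equiv.Perm {j // j ∈ A}) (τ : Equiv.Perm {j // ¬ j ∈ A}),
      rename (Sum.map σ τ) (rename e.symm f) = rename e.symm f := by
    intro σ τ
    have h1 := hf ((e.symm.trans (Equiv.sumCongr σ τ)).trans e) (by
      apply Finset.eq_of_subset_of_card_le
      · intro j hj
        simp only [Finset.mem_map] at hj
        obtain ⟨i, hi, rfl⟩ := hj
        simp [e, Equiv.sumCompl_symm_apply_of_pos hi]
      · simp)
    conv_rhs => rw [← h1]
    rw [rename_rename, rename_rename]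
    congr 2
    ext x
    simp
  have := ft_sum (rename e.symm f) (fun σ => by simpa using hs σ 1) (fun τ => by simpa using hs 1 τ)
  have h2 : rename e (rename e.symm f) ∈ Subalgebra.map (rename e) _ :=
    Subalgebra.mem_map.2 ⟨_, this, rfl⟩
  rw [rename_rename, AlgHom.map_adjoin] at h2
  simp only [Equiv.self_comp_symm, rename_id, AlgHom.id_apply] at h2
  refine Algebra.adjoin_mono ?_ h2
  rintro _ ⟨_, ⟨p, rfl⟩ | ⟨p, rfl⟩, rfl⟩
  · refine Or.inl ⟨p, ?_⟩
    have := @esymm_sub k _ n (fun j => j ∈ A) _ (Finset.Subtype.fintype A) p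
    simp only [Finset.filter_univ_mem] at this
    simp only [rename_rename]
    rw [← this]
    rfl
  · refine Or.inr ⟨p, ?_⟩
    have := esymm_sub k n (fun j => ¬ j ∈ A) p
    have hc : Finset.univ.filter (fun j => ¬ j ∈ A) = Aᶜ := by ext; simp
    rw [hc] at this
    simp only [rename_rename]
    rw [← this]
    rfl

theorem adC_le : adC k n ≤ invariants k n := by
  unfold adC
  rw [Algebra.adjoin_le_iff]
  rintro _ ⟨s, i, _, _, rfl⟩ σ
  exact c_inv k n σ s i

theorem exists_z (x : RR k n) (hx : x ∈ invariants k n) (a : ℕ) :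
    ∃ z ∈ adC k n, ∀ A : Finset (Fin n), A.card = a → phi k n A z = phi k n A x := by
  by_cases h : ∃ A : Finset (Fin n), A.card = a
  · obtain ⟨A, hA⟩ := h
    have hm := ft_A k n A (phi k n A x) (fun σ hσ => by
      rw [← phi_perm, hσ, hx σ])
    have hle : Algebra.adjoin k (Set.range (fun p => ∑ S ∈ Finset.powersetCard p A, ∏ j ∈ S, (X j : MvPolynomial (Fin n) k)) ∪
      Set.range (fun p => ∑ S ∈ Finset.powersetCard p Aᶜ, ∏ j ∈ S, X j)) ≤ (adC k n).map (phi k n A) := by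
      rw [Algebra.adjoin_le_iff]
      rintro _ (⟨p, rfl⟩ | ⟨p, rfl⟩)
      · by_cases hp : p ≤ A.card
        · exact ⟨_, DD_mem k n _ _, phi_D1 k n A p hp⟩
        · simp only
          rw [Finset.powersetCard_eq_empty.2 (by omega), Finset.sum_empty]
          exact Subalgebra.zero_mem _
      · exact ⟨_, DD_mem k n _ _, phi_D2 k n A p⟩
    obtain ⟨z, hz, hzx⟩ := hle hm
    refine ⟨z, hz, fun B hB => ?_⟩
    obtain ⟨σ, rfl⟩ : ∃ σ : Equiv.Perm (Fin n), A.map σ.toEmbedding = B := by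
      have e0 : {j // j ∈ A} ≃ {j // j ∈ B} := Fintype.equivOfCardEq (by simp [hA, hB])
      refine ⟨e0.extendSubtype, Finset.eq_of_subset_of_card_le ?_ (by simp [hA, hB])⟩
      intro j hj
      simp only [Finset.mem_map] at hj
      obtain ⟨i, hi, rfl⟩ := hj
      exact e0.extendSubtype_mem i hi
    rw [← hx σ, ← adC_le k n hz σ, phi_perm, phi_perm]
    exact congrArg _ hzx
  · exact ⟨0, Subalgebra.zero_mem _, fun A hA => (h ⟨A, hA⟩).elim⟩

theorem inv_le : invariants k n ≤ adC k n := by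
  intro x hx
  choose z hz hzx using exists_z k n x hx
  have : x = ∑ a ∈ Finset.range (n + 1), DD k n 0 a * z a := by
    apply phi_ext
    intro A
    rw [map_sum]
    simp only [map_mul, phi_D0, ite_mul, one_mul, zero_mul]
    rw [Finset.sum_ite_eq, if_pos, hzx _ A rfl]
    simpa [Nat.lt_succ_iff] using Finset.card_le_univ A
  rw [this]
  exact Subalgebra.sum_mem _ fun a _ => Subalgebra.mul_mem _ (DD_mem k n _ _) (hz a)

/-- the invariant subalgebra `R^{Σ_n}` is generated as a `k`-algebra by the
elements `c_{s,i}` for `s, i ≥ 0` with `1 ≤ s + i ≤ n`. -/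
theorem adjoin_cElt_eq_invariants (hn : 0 < n) :
    Algebra.adjoin k {x : RR k n | ∃ s i : ℕ, 1 ≤ s + i ∧ s + i ≤ n ∧ x = cElt k n s i}
      = invariants k n := by
  exact le_antisymm (adC_le k n) (inv_le k n)

end
end

section
/- The images of e_1, …, e_n in R are algebraically independent over k, and R^{Σ_n} is a finitely generated module over the k-subalgebra k[e_1,…,e_n] of R generated by them. -/
open MvPolynomial

noncomputable section

variable (k : Type) [CommRing k] (n : ℕ)

set_option synthInstance.maxHeartbeats 1000000
set_option maxHeartbeats 1000000

/-- `e_i = c_{i,0}`, the image in `R` of the `i`-th elementary symmetric polynomial in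
`w_1,…,w_n` (here `i : Fin n` encodes the index `i+1 ∈ {1,…,n}`). -/
def eElt (i : Fin n) : RR k n := cElt k n (i + 1) 0

theorem mk_rel (i : Fin n) :
    IsIdempotentElem (Ideal.Quotient.mk (Ideal.span (relSet k n)) (X (Sum.inr i))) := by
  unfold IsIdempotentElem
  rw [← map_mul, ← sub_eq_zero, ← map_sub, Ideal.Quotient.eq_zero_iff_mem, ← pow_two]
  exact Ideal.subset_span ⟨i, rfl⟩

theorem Cpoly_zero (s : ℕ) : Cpoly k n s 0 = rename Sum.inl (esymm (Fin n) k s) := by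
  classical
  unfold Cpoly
  rw [esymm, map_sum]
  symm
  refine Finset.sum_bij (fun t _ => (t, ∅)) ?_ ?_ ?_ ?_
  · intro t ht
    simp at ht
    simp [ht]
  · intro a _ b _ h
    simpa using h
  · rintro ⟨a, b⟩ h
    simp at h
    refine ⟨a, by simp [h.1], ?_⟩
    simp [h.2.1]
  · intro t _
    simp [map_prod]

theorem eElt_eq (i : Fin n) :
    eElt k n i = Ideal.Quotient.mk _ (rename Sum.inl (esymm (Fin n) k (i + 1))) := by
  rw [eElt, cElt, Cpoly_zero]

/-- retraction `w ↦ w`, `u ↦ 0` -/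
def retr : RR k n →ₐ[k] MvPolynomial (Fin n) k :=
  Ideal.Quotient.liftₐ (Ideal.span (relSet k n))
    (aeval (Sum.elim X (fun _ => 0)))
    (by
      intro a ha
      have : Ideal.span (relSet k n) ≤ RingHom.ker (aeval (Sum.elim X (fun _ => 0)) :
          MvPolynomial (Fin n ⊕ Fin n) k →ₐ[k] MvPolynomial (Fin n) k) := by
        rw [Ideal.span_le]
        rintro x ⟨i, rfl⟩
        simp [RingHom.mem_ker]
      exact this ha)

theorem retr_mk (p : MvPolynomial (Fin n ⊕ Fin n) k) :
    retr k n (Ideal.Quotient.mk _ p) = aeval (Sum.elim X (fun _ => 0)) p := rfl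

theorem algInd : AlgebraicIndependent k (eElt k n) := by
  apply AlgebraicIndependent.of_comp (retr k n)
  have h : (retr k n ∘ eElt k n) = fun i : Fin n => esymm (Fin n) k (i + 1) := by
    funext i
    rw [Function.comp_apply, eElt_eq, retr_mk, aeval_rename]
    exact aeval_X_left_apply _
  rw [h, AlgebraicIndependent]
  intro p q hpq
  apply esymmAlgHom_injective (σ := Fin n) k (n := n) (by simp)
  apply Subtype.ext
  rw [esymmAlgHom_apply, esymmAlgHom_apply]
  exact hpq

theorem integral_w (i : Fin n) :
    IsIntegral (Algebra.adjoin k (Set.range (eElt k n)))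
      (Ideal.Quotient.mk (Ideal.span (relSet k n)) (X (Sum.inl i))) := by
  set A := Algebra.adjoin k (Set.range (eElt k n)) with hA
  set w : RR k n := Ideal.Quotient.mk (Ideal.span (relSet k n)) (X (Sum.inl i)) with hw
  rw [← neg_neg w]
  apply IsIntegral.neg
  let a : Fin n → A := fun j => ⟨eElt k n j, Algebra.subset_adjoin ⟨j, rfl⟩⟩
  refine ⟨Polynomial.X ^ n + ∑ j : Fin n, Polynomial.C (a j) * Polynomial.X ^ (n - (j + 1)), ?_, ?_⟩
  · apply Polynomial.monic_X_pow_add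
    refine (Polynomial.degree_sum_le _ _).trans_lt ?_
    rw [Finset.sup_lt_iff (by exact WithBot.bot_lt_coe n)]
    intro j _
    refine (Polynomial.degree_C_mul_X_pow_le _ _).trans_lt ?_
    have := j.2
    exact_mod_cast (by omega : n - (j + 1) < n)
  · have h := congrArg (Polynomial.eval₂
      ((Ideal.Quotient.mk (Ideal.span (relSet k n))).comp
        (rename (R := k) (Sum.inl : Fin n → Fin n ⊕ Fin n)).toRingHom) (-w))
      (MvPolynomial.prod_C_add_X_eq_sum_esymm k (Fin n))
    rw [Polynomial.eval₂_finsetProd, Finset.prod_eq_zero (Finset.mem_univ i) (by simp [hw]),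
      Polynomial.eval₂_finsetSum, Fintype.card_fin, Finset.sum_range_succ', ] at h
    rw [Polynomial.eval₂_add, Polynomial.eval₂_finsetSum, h, add_comm, Finset.sum_range]
    congr 1
    · refine Finset.sum_congr rfl fun j _ => ?_
      simp only [Polynomial.eval₂_mul, Polynomial.eval₂_C, Polynomial.eval₂_X_pow]
      congr 1
      exact eElt_eq k n j
    · simp

theorem finite_RR : Module.Finite (Algebra.adjoin k (Set.range (eElt k n))) (RR k n) := by
  set A := Algebra.adjoin k (Set.range (eElt k n)) with hA
  have hft : Algebra.FiniteType A (RR k n) :=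
    Algebra.FiniteType.of_restrictScalars_finiteType k A (RR k n)
  have hint : Algebra.IsIntegral A (RR k n) := by
    constructor
    intro x
    obtain ⟨p, rfl⟩ := Ideal.Quotient.mk_surjective x
    induction p using MvPolynomial.induction_on with
    | C r =>
      exact isIntegral_algebraMap (R := A) (x := algebraMap k A r)
    | add p q hp hq => rw [map_add]; exact hp.add hq
    | mul_X p j hp =>
      rw [map_mul]
      refine hp.mul ?_
      rcases j with j | j
      · exact integral_w k n j
      · refine ⟨Polynomial.X ^ 2 - Polynomial.X, ?_, ?_⟩
        · rw [sub_eq_add_neg]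
          apply Polynomial.monic_X_pow_add
          rw [Polynomial.degree_neg]
          exact Polynomial.degree_X_le.trans_lt (by norm_num)
        · have := mk_rel k n j
          simp only [Polynomial.eval₂_sub, Polynomial.eval₂_X_pow, Polynomial.eval₂_X]
          rw [pow_two, this.eq, sub_self]
  exact @Algebra.IsIntegral.finite A (RR k n) _ _ _ hint hft

/-- Invariants as a submodule over the subalgebra generated by the `e_i`. -/
theorem permAut_mk (σ : Equiv.Perm (Fin n)) (p : MvPolynomial (Fin n ⊕ Fin n) k) :
    permAut k n σ (Ideal.Quotient.mk _ p) = Ideal.Quotient.mk _ (rename (Sum.map σ σ) p) := rfl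

theorem adjoin_le : Algebra.adjoin k (Set.range (eElt k n)) ≤ invariants k n := by
  rw [Algebra.adjoin_le_iff]
  rintro _ ⟨i, rfl⟩ σ
  rw [eElt_eq, permAut_mk, rename_rename]
  congr 1
  have : (Sum.map σ σ ∘ Sum.inl : Fin n → Fin n ⊕ Fin n) = Sum.inl ∘ σ := by
    funext; simp
  rw [this, ← rename_rename, rename_esymm]

def invSub : Submodule (Algebra.adjoin k (Set.range (eElt k n))) (RR k n) where
  carrier := invariants k n
  add_mem' := fun hx hy => (invariants k n).add_mem hx hy
  zero_mem' := (invariants k n).zero_mem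
  smul_mem' := fun c _ hx => (invariants k n).mul_mem (adjoin_le k n c.2) hx

theorem fg_int : (invSub ℤ n).FG := by
  have : IsNoetherianRing (Algebra.adjoin ℤ (Set.range (eElt ℤ n))) :=
    isNoetherianRing_of_fg (Subalgebra.fg_def.2 ⟨_, Set.finite_range _, rfl⟩)
  have := finite_RR ℤ n
  have : IsNoetherian (Algebra.adjoin ℤ (Set.range (eElt ℤ n))) (RR ℤ n) := inferInstance
  exact IsNoetherian.noetherian _

/-- Base change from the integers. -/
def bc : RR ℤ n →+* RR k n :=
  Ideal.quotientMap _ (MvPolynomial.map (Int.castRingHom k)) (by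
    rw [Ideal.span_le]
    rintro x ⟨i, rfl⟩
    refine Ideal.subset_span ⟨i, ?_⟩
    simp)

theorem bc_mk (p : MvPolynomial (Fin n ⊕ Fin n) ℤ) :
    bc k n (Ideal.Quotient.mk _ p) = Ideal.Quotient.mk _ (MvPolynomial.map (Int.castRingHom k) p) :=
  rfl

theorem bc_perm (σ : Equiv.Perm (Fin n)) (x : RR ℤ n) :
    bc k n (permAut ℤ n σ x) = permAut k n σ (bc k n x) := by
  obtain ⟨p, rfl⟩ := Ideal.Quotient.mk_surjective x
  rw [permAut_mk, bc_mk, bc_mk, permAut_mk, map_rename]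

theorem bc_e (i : Fin n) : bc k n (eElt ℤ n i) = eElt k n i := by
  rw [eElt_eq, eElt_eq, bc_mk, map_rename, map_esymm]

theorem bc_adjoin (x : RR ℤ n) (hx : x ∈ Algebra.adjoin ℤ (Set.range (eElt ℤ n))) :
    bc k n x ∈ Algebra.adjoin k (Set.range (eElt k n)) := by
  induction hx using Algebra.adjoin_induction with
  | mem x hx =>
    obtain ⟨i, rfl⟩ := hx
    rw [bc_e]
    exact Algebra.subset_adjoin ⟨i, rfl⟩
  | algebraMap r => simp
  | add x y _ _ hx hy => rw [map_add]; exact add_mem hx hy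
  | mul x y _ _ hx hy => rw [map_mul]; exact mul_mem hx hy

/-- Normal form on exponents. -/
def nfE (m : Fin n ⊕ Fin n →₀ ℕ) : Fin n ⊕ Fin n →₀ ℕ :=
  Finsupp.equivFunOnFinite.symm (Sum.elim (fun i => m (Sum.inl i)) (fun i => min (m (Sum.inr i)) 1))

/-- Normal form on polynomials. -/
def nf : MvPolynomial (Fin n ⊕ Fin n) k →ₗ[k] MvPolynomial (Fin n ⊕ Fin n) k :=
  (basisMonomials (Fin n ⊕ Fin n) k).constr k (fun m => monomial (nfE n m) 1)

theorem nf_monomial (m : Fin n ⊕ Fin n →₀ ℕ) (r : k) :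
    nf k n (monomial m r) = monomial (nfE n m) r := by
  have h : nf k n (monomial m 1) = monomial (nfE n m) 1 := by
    have := (basisMonomials (Fin n ⊕ Fin n) k).constr_basis k
      (fun m => (monomial (nfE n m) 1 : MvPolynomial (Fin n ⊕ Fin n) k)) m
    rwa [coe_basisMonomials] at this
  have e (m : Fin n ⊕ Fin n →₀ ℕ) : monomial m r = r • monomial m (1 : k) := by
    simp [smul_monomial]
  rw [e, map_smul, h, ← e]

theorem nf_ideal (x : MvPolynomial (Fin n ⊕ Fin n) k) (hx : x ∈ Ideal.span (relSet k n)) :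
    nf k n x = 0 := by
  suffices h : ∀ p, nf k n (p * x) = 0 by simpa using h 1
  induction hx using Submodule.span_induction with
  | mem x hx =>
    obtain ⟨i, rfl⟩ := hx
    intro p
    induction p using MvPolynomial.induction_on' with
    | monomial m r =>
      rw [mul_sub, X_pow_eq_monomial, X, monomial_mul, monomial_mul, map_sub, nf_monomial,
        nf_monomial, sub_eq_zero]
      congr 2
      ext j
      rcases j with j | j
      · simp [nfE]
      · simp only [nfE, Finsupp.equivFunOnFinite_symm_apply_apply, Sum.elim_inr,
          Finsupp.add_apply, Finsupp.single_apply]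
        split_ifs <;> omega
    | add p q hp hq => rw [add_mul, map_add, hp, hq, add_zero]
  | zero => simp
  | add x y _ _ hx hy => intro p; rw [mul_add, map_add, hx, hy, add_zero]
  | smul a x _ hx => intro p; rw [smul_eq_mul, ← mul_assoc]; exact hx _

theorem mk_nf (p : MvPolynomial (Fin n ⊕ Fin n) k) :
    Ideal.Quotient.mk (Ideal.span (relSet k n)) (nf k n p) = Ideal.Quotient.mk _ p := by
  induction p using MvPolynomial.induction_on' with
  | monomial m r =>
    rw [nf_monomial, monomial_eq, monomial_eq, map_mul, map_mul]
    congr 1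
    rw [Finsupp.prod_fintype _ _ (by simp), Finsupp.prod_fintype _ _ (by simp), map_prod, map_prod]
    refine Finset.prod_congr rfl fun j _ => ?_
    rcases j with j | j
    · simp [nfE]
    · rw [map_pow, map_pow]
      simp only [nfE, Finsupp.equivFunOnFinite_symm_apply_apply, Sum.elim_inr]
      rcases m (Sum.inr j) with _ | b
      · simp
      · rw [(mk_rel k n j).pow_succ_eq, Nat.min_eq_right (by omega), pow_one]
  | add p q hp hq => simp only [map_add, hp, hq]

theorem nf_rename (σ : Equiv.Perm (Fin n)) (p : MvPolynomial (Fin n ⊕ Fin n) k) :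
    nf k n (rename (Sum.map σ σ) p) = rename (Sum.map σ σ) (nf k n p) := by
  have hs : (Sum.map σ σ : Fin n ⊕ Fin n → _) = Equiv.sumCongr σ σ := by
    funext j; rcases j with j | j <;> simp
  induction p using MvPolynomial.induction_on' with
  | monomial m r =>
    rw [nf_monomial, rename_monomial, rename_monomial, nf_monomial]
    refine congrArg (fun e => monomial e r) ?_
    rw [hs]
    ext j
    rw [← Finsupp.equivMapDomain_eq_mapDomain, ← Finsupp.equivMapDomain_eq_mapDomain]
    rcases j with j | j <;> simp [nfE, Finsupp.equivMapDomain_apply]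
  | add p q hp hq => simp only [map_add, hp, hq]

theorem lift_inv (x : RR k n) (hx : x ∈ invariants k n) :
    ∃ p, Ideal.Quotient.mk _ p = x ∧ ∀ σ : Equiv.Perm (Fin n), rename (Sum.map σ σ) p = p := by
  obtain ⟨q, rfl⟩ := Ideal.Quotient.mk_surjective x
  refine ⟨nf k n q, mk_nf k n q, fun σ => ?_⟩
  have h := hx σ
  rw [permAut_mk, ← sub_eq_zero, ← map_sub, Ideal.Quotient.eq_zero_iff_mem] at h
  have := nf_ideal k n _ h
  rw [map_sub, sub_eq_zero, nf_rename] at this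
  exact this

/-- Action on exponents. -/
def actE (σ : Equiv.Perm (Fin n)) (m : Fin n ⊕ Fin n →₀ ℕ) : Fin n ⊕ Fin n →₀ ℕ :=
  m.mapDomain (Sum.map σ σ)

theorem actE_mul (σ τ : Equiv.Perm (Fin n)) (m : Fin n ⊕ Fin n →₀ ℕ) :
    actE n σ (actE n τ m) = actE n (σ * τ) m := by
  rw [actE, actE, actE, ← Finsupp.mapDomain_comp, Sum.map_comp_map]
  rfl

theorem actE_one (m : Fin n ⊕ Fin n →₀ ℕ) : actE n 1 m = m := by
  have : (Sum.map (1 : Equiv.Perm (Fin n)) (1 : Equiv.Perm (Fin n))) = id := by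
    funext j; rcases j with j | j <;> simp
  rw [actE, this, Finsupp.mapDomain_id]

open Classical in
/-- The orbit of an exponent. -/
def orbE (m : Fin n ⊕ Fin n →₀ ℕ) : Finset (Fin n ⊕ Fin n →₀ ℕ) :=
  Finset.univ.image (fun σ => actE n σ m)

theorem mem_orbE (m m' : Fin n ⊕ Fin n →₀ ℕ) : m' ∈ orbE n m ↔ ∃ σ, actE n σ m = m' := by
  simp [orbE]

theorem self_mem (m : Fin n ⊕ Fin n →₀ ℕ) : m ∈ orbE n m :=
  (mem_orbE n _ _).2 ⟨1, actE_one n m⟩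

theorem orbE_act (σ : Equiv.Perm (Fin n)) (m : Fin n ⊕ Fin n →₀ ℕ) :
    orbE n (actE n σ m) = orbE n m := by
  ext m'
  rw [mem_orbE, mem_orbE]
  constructor
  · rintro ⟨τ, rfl⟩
    exact ⟨τ * σ, by rw [actE_mul]⟩
  · rintro ⟨τ, rfl⟩
    exact ⟨τ * σ⁻¹, by rw [actE_mul]; simp⟩

/-- Orbit sum. -/
def orbSum (m : Fin n ⊕ Fin n →₀ ℕ) : MvPolynomial (Fin n ⊕ Fin n) k :=
  ∑ m' ∈ orbE n m, monomial m' 1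

theorem actE_inj (σ : Equiv.Perm (Fin n)) : Function.Injective (actE n σ) := by
  intro a b h
  have := congrArg (actE n σ⁻¹) h
  simpa [actE_mul, actE_one] using this

theorem orbSum_inv (σ : Equiv.Perm (Fin n)) (m : Fin n ⊕ Fin n →₀ ℕ) :
    rename (Sum.map σ σ) (orbSum k n m) = orbSum k n m := by
  rw [orbSum, map_sum]
  refine Finset.sum_bij (fun m' _ => actE n σ m') ?_ ?_ ?_ ?_
  · intro a ha
    rw [mem_orbE] at ha ⊢
    obtain ⟨τ, rfl⟩ := ha
    exact ⟨σ * τ, by rw [actE_mul]⟩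
  · intro a _ b _ h
    exact actE_inj n σ h
  · intro b hb
    rw [mem_orbE] at hb
    obtain ⟨τ, rfl⟩ := hb
    exact ⟨actE n (σ⁻¹ * τ) m, (mem_orbE n _ _).2 ⟨_, rfl⟩, by simp [actE_mul]⟩
  · intro a _
    rw [rename_monomial]
    rfl

theorem coeff_act (p : MvPolynomial (Fin n ⊕ Fin n) k)
    (hp : ∀ σ : Equiv.Perm (Fin n), rename (Sum.map σ σ) p = p)
    (σ : Equiv.Perm (Fin n)) (m : Fin n ⊕ Fin n →₀ ℕ) :
    coeff (actE n σ m) p = coeff m p := by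
  conv_lhs => rw [← hp σ]
  exact coeff_rename_mapDomain _ (Sum.map_injective.2 ⟨σ.injective, σ.injective⟩) _ _

theorem mem_span_orbSum (p : MvPolynomial (Fin n ⊕ Fin n) k)
    (hp : ∀ σ : Equiv.Perm (Fin n), rename (Sum.map σ σ) p = p) :
    p ∈ Submodule.span k (Set.range (orbSum k n)) := by
  classical
  rw [p.as_sum, ← Finset.sum_fiberwise_of_maps_to (t := p.support.image (orbE n)) (g := orbE n)
    (fun m hm => Finset.mem_image_of_mem _ hm)]
  refine Submodule.sum_mem _ fun O hO => ?_
  obtain ⟨m, hm, rfl⟩ := Finset.mem_image.1 hO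
  have h1 : p.support.filter (fun m' => orbE n m' = orbE n m) = orbE n m := by
    ext m'
    rw [Finset.mem_filter]
    constructor
    · rintro ⟨_, h⟩
      rw [← h]
      exact self_mem n m'
    · intro h
      obtain ⟨σ, rfl⟩ := (mem_orbE n _ _).1 h
      refine ⟨?_, orbE_act n σ m⟩
      rw [mem_support_iff, coeff_act k n p hp]
      exact mem_support_iff.1 hm
  have h2 : ∑ m' ∈ orbE n m, monomial m' (coeff m' p) = coeff m p • orbSum k n m := by
    rw [orbSum, Finset.smul_sum]
    refine Finset.sum_congr rfl fun m' h => ?_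
    obtain ⟨σ, rfl⟩ := (mem_orbE n _ _).1 h
    rw [coeff_act k n p hp, smul_monomial, smul_eq_mul, mul_one]
  rw [h1, h2]
  exact Submodule.smul_mem _ _ (Submodule.subset_span ⟨m, rfl⟩)

theorem bc_orbSum (m : Fin n ⊕ Fin n →₀ ℕ) :
    bc k n (Ideal.Quotient.mk _ (orbSum ℤ n m)) = Ideal.Quotient.mk _ (orbSum k n m) := by
  rw [bc_mk, orbSum, orbSum, map_sum]
  congr 1
  refine Finset.sum_congr rfl fun m' _ => ?_
  rw [map_monomial, map_one]

theorem bc_span (s : Set (RR ℤ n)) (y : RR ℤ n)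
    (hy : y ∈ Submodule.span (Algebra.adjoin ℤ (Set.range (eElt ℤ n))) s) :
    bc k n y ∈ Submodule.span (Algebra.adjoin k (Set.range (eElt k n))) (bc k n '' s) := by
  induction hy using Submodule.span_induction with
  | mem x hx => exact Submodule.subset_span ⟨x, hx, rfl⟩
  | zero => rw [map_zero]; exact Submodule.zero_mem _
  | add x y _ _ hx hy => rw [map_add]; exact Submodule.add_mem _ hx hy
  | smul a x _ hx =>
    rw [Subalgebra.smul_def, smul_eq_mul, map_mul]
    exact Submodule.smul_mem _ (⟨bc k n a, bc_adjoin k n a a.2⟩ :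
      Algebra.adjoin k (Set.range (eElt k n))) hx

theorem finite_part : ∃ s : Finset (RR k n),
      (↑s : Set (RR k n)) ⊆ (invariants k n : Set (RR k n)) ∧
      ∀ x ∈ invariants k n,
        x ∈ Submodule.span (Algebra.adjoin k (Set.range (eElt k n))) (↑s : Set (RR k n)) := by
  classical
  obtain ⟨t, ht⟩ := fg_int n
  refine ⟨t.image (bc k n), ?_, ?_⟩
  · intro y hy
    rw [Finset.coe_image] at hy
    obtain ⟨z, hz, rfl⟩ := hy
    have hz' : z ∈ invSub ℤ n := ht ▸ Submodule.subset_span hz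
    intro σ
    rw [← bc_perm]
    congr 1
    exact hz' σ
  · intro x hx
    rw [Finset.coe_image]
    obtain ⟨p, rfl, hp⟩ := lift_inv k n x hx
    have hspan := mem_span_orbSum k n p hp
    clear hx hp
    induction hspan using Submodule.span_induction with
    | mem x hx =>
      obtain ⟨m, rfl⟩ := hx
      rw [← bc_orbSum]
      apply bc_span
      rw [ht]
      intro σ
      rw [permAut_mk, orbSum_inv]
    | zero => rw [map_zero]; exact Submodule.zero_mem _
    | add x y _ _ hx hy => rw [map_add]; exact Submodule.add_mem _ hx hy
    | smul a x _ hx =>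
      have : Ideal.Quotient.mk (Ideal.span (relSet k n)) (a • x) =
        (algebraMap k (Algebra.adjoin k (Set.range (eElt k n))) a) •
          Ideal.Quotient.mk (Ideal.span (relSet k n)) x := by
        rw [algebraMap_smul]
        rfl
      rw [this]
      exact Submodule.smul_mem _ _ hx

/-- the images of `e_1, …, e_n` in `R` are algebraically independent over `k`,
and `R^{Σ_n}` is a finitely generated module over the subalgebra `k[e_1,…,e_n]`. -/
theorem algIndep_esymm_and_finite (hn : 0 < n) :
    AlgebraicIndependent k (eElt k n) ∧
    ∃ s : Finset (RR k n),
      (↑s : Set (RR k n)) ⊆ (invariants k n : Set (RR k n)) ∧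
      ∀ x ∈ invariants k n,
        x ∈ Submodule.span (Algebra.adjoin k (Set.range (eElt k n))) (↑s : Set (RR k n)) := by
  exact ⟨algInd k n, finite_part k n⟩

end
end

section
/- Let A be a commutative ring, let e_1, …, e_n ∈ A be idempotents (e_i² = e_i), and set u = e_1 + ⋯ + e_n. Then u(u − 1)(u − 2)⋯(u − n) = 0, i.e. the product ∏_{j=0}^{n} (u − j·1_A) vanishes. -/
theorem aux_mul_prod {A : Type*} [CommRing A] (c : A) (f g : ℕ → A)
    (h : ∀ j, c * f j = c * g j) (n : ℕ) :
    c * ∏ j ∈ Finset.range n, f j = c * ∏ j ∈ Finset.range n, g j := by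
  induction n with
  | zero => simp
  | succ k ih =>
    rw [Finset.prod_range_succ, Finset.prod_range_succ, ← mul_assoc, ih,
      mul_right_comm, h, mul_right_comm, mul_assoc]

/-- if `e_1, …, e_n` are idempotents in a commutative ring `A` and
`u = e_1 + ⋯ + e_n`, then `u(u − 1)(u − 2)⋯(u − n) = 0`. -/
theorem prod_sub_eq_zero_of_idempotents (A : Type*) [CommRing A] (n : ℕ)
    (e : Fin n → A) (he : ∀ i, e i ^ 2 = e i) :
    ∏ j ∈ Finset.range (n + 1), ((∑ i, e i) - (j : A)) = 0 := by
  induction n with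
  | zero => simp
  | succ n ih =>
    have ih' := ih (fun i => e i.succ) (fun i => he _)
    rw [Fin.sum_univ_succ]
    have h0 := he 0
    generalize (∑ i : Fin n, e i.succ) = v at *
    generalize e 0 = a at *
    have h1 := aux_mul_prod a (fun j : ℕ => a + v - (j : A)) (fun j : ℕ => v + 1 - (j : A))
      (fun j => by linear_combination h0) (n + 1 + 1)
    have h2 := aux_mul_prod (1 - a) (fun j : ℕ => a + v - (j : A)) (fun j : ℕ => v - (j : A))
      (fun j => by linear_combination -h0) (n + 1 + 1)
    have h3 : ∏ j ∈ Finset.range (n + 1 + 1), (v + 1 - (j : A)) = 0 := by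
      rw [Finset.prod_range_succ']
      have : ∀ k : ℕ, v + 1 - ((k + 1 : ℕ) : A) = v - k := fun k => by push_cast; ring
      simp only [this, ih', zero_mul]
    have h4 : ∏ j ∈ Finset.range (n + 1 + 1), (v - (j : A)) = 0 := by
      rw [Finset.prod_range_succ, ih', zero_mul]
    simp only [h3] at h1
    simp only [h4] at h2
    linear_combination h1 + h2
end

section
/- Let A be a commutative ring, let e_1, …, e_n ∈ A be idempotents (e_i² = e_i), and set u = e_1 + ⋯ + e_n. Then for every 1 ≤ i ≤ n, the i-th elementary symmetric polynomial evaluated at e_1, …, e_n satisfies i!·σ_i(e_1,…,e_n) = u(u − 1)⋯(u − i + 1), the i-fold falling factorial of u. -/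
theorem esymm_insert_aux {A ι : Type*} [CommRing A] [DecidableEq ι] (e : ι → A) (s : Finset ι)
    (a : ι) (ha : a ∉ s) (k : ℕ) :
    ∑ S ∈ (insert a s).powersetCard (k+1), ∏ l ∈ S, e l
      = ∑ S ∈ s.powersetCard (k+1), ∏ l ∈ S, e l
        + e a * ∑ S ∈ s.powersetCard k, ∏ l ∈ S, e l := by
  have hn : ∀ S ∈ s.powersetCard k, a ∉ S := fun S hS h =>
    ha ((Finset.mem_powersetCard.1 hS).1 h)
  rw [Finset.powersetCard_succ_insert ha, Finset.sum_union, Finset.sum_image, Finset.mul_sum]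
  · congr 1
    exact Finset.sum_congr rfl fun S hS => Finset.prod_insert (hn S hS)
  · intro S hS T hT h
    have := congrArg (fun U => Finset.erase U a) h
    simpa [Finset.erase_insert (hn S hS), Finset.erase_insert (hn T hT)] using this
  · rw [Finset.disjoint_left]
    intro S hS hT
    obtain ⟨T, -, rfl⟩ := Finset.mem_image.1 hT
    exact ha ((Finset.mem_powersetCard.1 hS).1 (Finset.mem_insert_self a T))

theorem esymm_step_aux {A ι : Type*} [CommRing A] [DecidableEq ι] (e : ι → A)
    (he : ∀ i, e i ^ 2 = e i) (s : Finset ι) : ∀ k : ℕ,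
    ((k : A) + 1) * ∑ S ∈ s.powersetCard (k+1), ∏ l ∈ S, e l
      = (∑ S ∈ s.powersetCard k, ∏ l ∈ S, e l) * ((∑ m ∈ s, e m) - (k : A)) := by
  induction s using Finset.induction_on with
  | empty =>
    have h0 : ∀ k : ℕ, Finset.powersetCard (k+1) (∅ : Finset ι) = ∅ := fun k =>
      Finset.powersetCard_eq_empty.2 (by simp)
    intro k
    cases k with
    | zero => rw [h0]; simp
    | succ k => rw [h0, h0]; simp
  | insert a s ha ih =>
    intro k
    cases k with
    | zero =>
      have h := ih 0
      rw [esymm_insert_aux e s a ha, Finset.sum_insert ha]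
      simp only [Finset.powersetCard_zero, Finset.sum_singleton, Finset.prod_empty] at h ⊢
      push_cast at h ⊢
      linear_combination h
    | succ k =>
      rw [esymm_insert_aux e s a ha, esymm_insert_aux e s a ha, Finset.sum_insert ha]
      have h1 := ih (k+1)
      have h2 := ih k
      push_cast at h1 ⊢
      linear_combination h1 + e a * h2 - (∑ S ∈ s.powersetCard k, ∏ l ∈ S, e l) * he a

/-- if `e_1, …, e_n` are idempotents in a commutative ring `A` and
`u = e_1 + ⋯ + e_n`, then for every `1 ≤ i ≤ n`,
`i!·σ_i(e_1,…,e_n) = u(u − 1)⋯(u − i + 1)` (the `i`-fold falling factorial of `u`),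
where `σ_i` is the `i`-th elementary symmetric polynomial. -/
theorem factorial_mul_esymm_of_idempotents (A : Type*) [CommRing A] (n : ℕ)
    (e : Fin n → A) (he : ∀ i, e i ^ 2 = e i) (i : ℕ) (h1 : 1 ≤ i) (h2 : i ≤ n) :
    (i.factorial : A) * ∑ S ∈ Finset.univ.powersetCard i, ∏ l ∈ S, e l
      = ∏ j ∈ Finset.range i, ((∑ m, e m) - (j : A)) := by
  clear h1 h2
  induction i with
  | zero => simp
  | succ k ih =>
    rw [Finset.prod_range_succ, ← ih, Nat.factorial_succ]
    have h := esymm_step_aux e he Finset.univ k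
    push_cast
    linear_combination (k.factorial : A) * h
end

section
/- Let A be a commutative ring and define the binary operation a ⊕ b = a + b − 2ab on A. If e_1, …, e_n ∈ A are idempotents, then the iterated operation e_1 ⊕ e_2 ⊕ ⋯ ⊕ e_n equals Σ_{i=1}^{n} (−2)^{i−1} σ_i(e_1,…,e_n); in particular this element is an idempotent of A. -/
theorem oplus_aux {A ι : Type*} [CommRing A] [DecidableEq ι] (e : ι → A) (l : List ι)
    (hl : l.Nodup) :
    (l.map e).foldr (fun a b => a + b - 2 * (a * b)) 0
      = ∑ T ∈ l.toFinset.powerset,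
          (if T.card = 0 then 0 else (-2 : A) ^ (T.card - 1)) * ∏ i ∈ T, e i := by
  induction l with
  | nil => simp
  | cons a l ih =>
    have ha : a ∉ l.toFinset := by simpa using (List.nodup_cons.1 hl).1
    have ih := ih (List.nodup_cons.1 hl).2
    rw [List.map_cons, List.foldr_cons, ih, List.toFinset_cons, Finset.sum_powerset_insert ha]
    generalize l.toFinset = s at ha
    have h1 : ∑ T ∈ s.powerset, (-2 : A) ^ T.card * ∏ i ∈ T, e i
        = 1 - 2 * ∑ T ∈ s.powerset,
          (if T.card = 0 then 0 else (-2 : A) ^ (T.card - 1)) * ∏ i ∈ T, e i := by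
      have h0 : (1 : A) = ∑ T ∈ s.powerset, if T = ∅ then 1 else 0 := by simp
      rw [h0, Finset.mul_sum, ← Finset.sum_sub_distrib]
      refine Finset.sum_congr rfl fun T _ => ?_
      by_cases hT : T = ∅
      · simp [hT]
      · have hc : T.card ≠ 0 := by simpa using hT
        obtain ⟨k, hk⟩ := Nat.exists_eq_succ_of_ne_zero hc
        simp only [hT, hk, if_false, Nat.succ_ne_zero, Nat.succ_eq_add_one,
          Nat.add_sub_cancel, pow_succ]
        ring
    have h2 : ∑ T ∈ s.powerset, (if (insert a T).card = 0 then 0 else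
          (-2 : A) ^ ((insert a T).card - 1)) * ∏ i ∈ insert a T, e i
        = e a * ∑ T ∈ s.powerset, (-2 : A) ^ T.card * ∏ i ∈ T, e i := by
      rw [Finset.mul_sum]
      refine Finset.sum_congr rfl fun T hT => ?_
      have haT : a ∉ T := fun h => ha (Finset.mem_powerset.1 hT h)
      rw [Finset.card_insert_of_notMem haT, Finset.prod_insert haT]
      simp only [Nat.succ_ne_zero, if_false, Nat.add_sub_cancel]
      ring
    rw [h2, h1]
    ring

theorem oplus_idem {A : Type*} [CommRing A] (l : List A) (hl : ∀ a ∈ l, a ^ 2 = a) :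
    (l.foldr (fun a b => a + b - 2 * (a * b)) 0) ^ 2
      = l.foldr (fun a b => a + b - 2 * (a * b)) 0 := by
  induction l with
  | nil => simp
  | cons a l ih =>
    have ha := hl a (by simp)
    have ih := ih fun b hb => hl b (by simp [hb])
    rw [List.foldr_cons]
    generalize l.foldr (fun a b => a + b - 2 * (a * b)) 0 = b at ih
    linear_combination (1 - 4 * b + 4 * b ^ 2) * ha + (1 - 4 * a + 4 * a) * ih

/-- let `a ⊕ b = a + b − 2ab` on a commutative ring `A`. If `e_1, …, e_n` are
idempotents, then `e_1 ⊕ ⋯ ⊕ e_n = Σ_{i=1}^{n} (−2)^{i−1} σ_i(e_1,…,e_n)`, and this element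
is idempotent. (The iterated operation is computed as a fold; `0` is a right identity for `⊕`,
so the fold with initial value `0` computes `e_1 ⊕ (e_2 ⊕ (⋯ ⊕ e_n))`.) -/
theorem iterated_oplus_of_idempotents (A : Type*) [CommRing A] (n : ℕ) (hn : 1 ≤ n)
    (e : Fin n → A) (he : ∀ i, e i ^ 2 = e i) :
    ((List.ofFn e).foldr (fun a b => a + b - 2 * (a * b)) 0
        = ∑ i ∈ Finset.range n,
            ((-2 : A) ^ i * ∑ S ∈ Finset.univ.powersetCard (i + 1), ∏ l ∈ S, e l)) ∧
      (((List.ofFn e).foldr (fun a b => a + b - 2 * (a * b)) 0) ^ 2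
        = (List.ofFn e).foldr (fun a b => a + b - 2 * (a * b)) 0) := by
  refine ⟨?_, oplus_idem _ ?_⟩
  · rw [List.ofFn_eq_map, oplus_aux e _ (List.nodup_finRange n), List.toFinset_finRange,
      Finset.sum_powerset, Finset.card_univ, Fintype.card_fin, Finset.sum_range_succ']
    simp only [Finset.powersetCard_zero, Finset.sum_singleton, Finset.card_empty, if_true,
      zero_mul, add_zero]
    refine Finset.sum_congr rfl fun i _ => ?_
    rw [Finset.mul_sum]
    refine Finset.sum_congr rfl fun S hS => ?_
    rw [(Finset.mem_powersetCard.1 hS).2]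
    simp
  · intro a ha
    obtain ⟨i, rfl⟩ := (List.mem_ofFn' e a).1 ha
    exact he i
end

section
/- In the polynomial ring k[w_1,…,w_n,u_1,…,u_n] over a nontrivial commutative ring k, equipped with the lexicographic monomial order for which w_1 > w_2 > ⋯ > w_n > u_1 > ⋯ > u_n, the polynomial C_{s,i} (for integers s, i ≥ 0 with 1 ≤ s + i ≤ n) has leading monomial w_1⋯w_s·u_{s+1}⋯u_{s+i}, with leading coefficient 1. -/
open MvPolynomial

noncomputable section

open scoped Classical

variable (k : Type) [CommRing k] [Nontrivial k] (n : ℕ)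

/-- Lexicographic comparison of monomials (exponent vectors) in the variable order
`w_1 > ⋯ > w_n > u_1 > ⋯ > u_n`: `a` is lex-smaller than `b` if there is a variable `v` with
`a v < b v` such that `a` and `b` agree on all variables strictly earlier than `v`. -/
def MonLT (a b : (Fin n ⊕ Fin n) →₀ ℕ) : Prop :=
  ∃ v : Fin n ⊕ Fin n, a v < b v ∧
    ∀ v' : Fin n ⊕ Fin n, Sum.Lex (· < ·) (· < ·) v' v → a v' = b v'

/-- The exponent vector of the monomial `w_1⋯w_s·u_{s+1}⋯u_{s+i}`. -/
def M0 (s i : ℕ) : (Fin n ⊕ Fin n) →₀ ℕ :=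
  ∑ v ∈ Finset.univ.filter
      (fun v : Fin n ⊕ Fin n =>
        Sum.elim (fun m : Fin n => (m : ℕ) < s)
          (fun l : Fin n => s ≤ (l : ℕ) ∧ (l : ℕ) < s + i) v),
    Finsupp.single v 1

/-- Exponent vector attached to a pair of subsets. -/
def Evec (p : Finset (Fin n) × Finset (Fin n)) : (Fin n ⊕ Fin n) →₀ ℕ :=
  ∑ m ∈ p.1, Finsupp.single (Sum.inl m) 1 + ∑ l ∈ p.2, Finsupp.single (Sum.inr l) 1

theorem Evec_inl (p : Finset (Fin n) × Finset (Fin n)) (j : Fin n) :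
    Evec n p (Sum.inl j) = if j ∈ p.1 then 1 else 0 := by
  simp [Evec, Finsupp.finsetSum_apply, Finsupp.single_apply]

theorem Evec_inr (p : Finset (Fin n) × Finset (Fin n)) (j : Fin n) :
    Evec n p (Sum.inr j) = if j ∈ p.2 then 1 else 0 := by
  simp [Evec, Finsupp.finsetSum_apply, Finsupp.single_apply]

theorem Evec_inj {p q : Finset (Fin n) × Finset (Fin n)} (h : Evec n p = Evec n q) : p = q := by
  refine Prod.ext (Finset.ext fun j => ?_) (Finset.ext fun j => ?_)
  · have := DFunLike.congr_fun h (Sum.inl j)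
    rw [Evec_inl, Evec_inl] at this
    by_cases h1 : j ∈ p.1 <;> by_cases h2 : j ∈ q.1 <;> simp_all
  · have := DFunLike.congr_fun h (Sum.inr j)
    rw [Evec_inr, Evec_inr] at this
    by_cases h1 : j ∈ p.2 <;> by_cases h2 : j ∈ q.2 <;> simp_all

/-- The pair of subsets of the leading monomial. -/
def P0 (s i : ℕ) : Finset (Fin n) × Finset (Fin n) :=
  (Finset.univ.filter (fun m : Fin n => (m : ℕ) < s),
   Finset.univ.filter (fun l : Fin n => s ≤ (l : ℕ) ∧ (l : ℕ) < s + i))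

theorem mem_P0_fst (s i : ℕ) (j : Fin n) : j ∈ (P0 n s i).1 ↔ (j : ℕ) < s := by
  simp [P0]

theorem mem_P0_snd (s i : ℕ) (j : Fin n) :
    j ∈ (P0 n s i).2 ↔ s ≤ (j : ℕ) ∧ (j : ℕ) < s + i := by
  simp [P0]

theorem M0_eq (s i : ℕ) : M0 n s i = Evec n (P0 n s i) := by
  ext v
  rcases v with j | j
  · simp only [Evec_inl, mem_P0_fst]
    simp [M0, Finsupp.finsetSum_apply, Finsupp.single_apply]
  · simp only [Evec_inr, mem_P0_snd]
    simp [M0, Finsupp.finsetSum_apply, Finsupp.single_apply]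

theorem card_P0_fst (s i : ℕ) (h2 : s + i ≤ n) : (P0 n s i).1.card = s := by
  rw [← Finset.card_map Fin.valEmbedding]
  have : (P0 n s i).1.map Fin.valEmbedding = Finset.range s := by
    ext a
    simp only [Finset.mem_map, mem_P0_fst, Fin.valEmbedding_apply, Finset.mem_range]
    exact ⟨by rintro ⟨x, hx, rfl⟩; exact hx, fun h => ⟨⟨a, by omega⟩, h, rfl⟩⟩
  rw [this, Finset.card_range]

theorem card_P0_snd (s i : ℕ) (h2 : s + i ≤ n) : (P0 n s i).2.card = i := by
  rw [← Finset.card_map Fin.valEmbedding]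
  have : (P0 n s i).2.map Fin.valEmbedding = Finset.Ico s (s + i) := by
    ext a
    simp only [Finset.mem_map, mem_P0_snd, Fin.valEmbedding_apply, Finset.mem_Ico]
    exact ⟨by rintro ⟨x, hx, rfl⟩; exact hx, fun h => ⟨⟨a, by omega⟩, h, rfl⟩⟩
  rw [this, Nat.card_Ico]; omega

theorem term_eq (p : Finset (Fin n) × Finset (Fin n)) :
    ((∏ m ∈ p.1, X (Sum.inl m)) * ∏ l ∈ p.2, X (Sum.inr l) : MvPolynomial (Fin n ⊕ Fin n) k)
      = monomial (Evec n p) 1 := by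
  have e : ∀ (A : Finset (Fin n)) (f : Fin n → Fin n ⊕ Fin n),
      (∏ m ∈ A, X (f m) : MvPolynomial (Fin n ⊕ Fin n) k)
        = monomial (∑ m ∈ A, Finsupp.single (f m) 1) 1 := by
    intro A f
    rw [monomial_sum_one]
    rfl
  rw [e, e, monomial_mul, one_mul]
  rfl

theorem coeff_Cpoly (s i : ℕ) (m : (Fin n ⊕ Fin n) →₀ ℕ) :
    coeff m (Cpoly k n s i) = ∑ p ∈ Finset.univ.filter
      (fun p : Finset (Fin n) × Finset (Fin n) =>
        p.1.card = s ∧ p.2.card = i ∧ Disjoint p.1 p.2), if Evec n p = m then 1 else 0 := by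
  rw [Cpoly, coeff_sum]
  refine Finset.sum_congr rfl fun p _ => ?_
  rw [term_eq, coeff_monomial]

theorem exists_min_diff (A B : Finset (Fin n)) (hc : A.card = B.card) (hne : A ≠ B) :
    ∃ j ∈ B, j ∉ A ∧ ∀ j' < j, j' ∈ B → j' ∈ A := by
  have hn : (B \ A).Nonempty := by
    rw [Finset.sdiff_nonempty]
    intro h
    exact hne (Finset.eq_of_subset_of_card_le h hc.le).symm
  have hm := Finset.min'_mem _ hn
  rw [Finset.mem_sdiff] at hm
  refine ⟨_, hm.1, hm.2, fun j' hj hB => ?_⟩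
  by_contra hA
  exact absurd (Finset.min'_le _ j' (Finset.mem_sdiff.2 ⟨hB, hA⟩)) (not_le.2 hj)

/-- for `s, i ≥ 0` with `1 ≤ s + i ≤ n`, the polynomial `C_{s,i}` has leading
monomial `w_1⋯w_s·u_{s+1}⋯u_{s+i}` with leading coefficient `1`, for the lexicographic
monomial order with `w_1 > ⋯ > w_n > u_1 > ⋯ > u_n`. -/
theorem Cpoly_leading_monomial (s i : ℕ) (h1 : 1 ≤ s + i) (h2 : s + i ≤ n) :
    coeff (M0 n s i) (Cpoly k n s i) = 1 ∧
      ∀ m ∈ (Cpoly k n s i).support, m ≠ M0 n s i → MonLT n m (M0 n s i) := by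
  constructor
  · rw [coeff_Cpoly, Finset.sum_eq_single (P0 n s i)]
    · rw [if_pos (M0_eq n s i).symm]
    · intro q _ hq
      rw [if_neg]
      rw [M0_eq]
      exact fun h => hq (Evec_inj n h)
    · intro h
      refine absurd ?_ h
      rw [Finset.mem_filter]
      refine ⟨Finset.mem_univ _, card_P0_fst n s i h2, card_P0_snd n s i h2, ?_⟩
      rw [Finset.disjoint_left]
      intro a ha hb
      rw [mem_P0_fst] at ha
      rw [mem_P0_snd] at hb
      omega
  · intro m hm hne
    rw [mem_support_iff, coeff_Cpoly] at hm
    obtain ⟨p, hp, hpm⟩ := Finset.exists_ne_zero_of_sum_ne_zero hm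
    have hpm : Evec n p = m := by
      by_contra h
      exact hpm (if_neg h)
    subst hpm
    obtain ⟨-, hA, hB, hd⟩ := Finset.mem_filter.1 hp
    rw [M0_eq] at hne ⊢
    by_cases hAe : p.1 = (P0 n s i).1
    · have hBe : p.2 ≠ (P0 n s i).2 := fun h => hne (by rw [Prod.ext hAe h])
      obtain ⟨j, hj, hj', hmin⟩ := exists_min_diff n _ _
        (hB.trans (card_P0_snd n s i h2).symm) hBe
      refine ⟨Sum.inr j, ?_, ?_⟩
      · rw [Evec_inr, Evec_inr, if_neg hj', if_pos hj]; exact one_pos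
      · rintro (v | v) hv
        · rw [Evec_inl, Evec_inl, hAe]
        · have hv : v < j := by simpa using hv
          have hiff : v ∈ p.2 ↔ v ∈ (P0 n s i).2 := by
            refine ⟨fun h => ?_, hmin v hv⟩
            have h3 : v ∉ p.1 := fun h' => Finset.disjoint_left.1 hd h' h
            rw [hAe, mem_P0_fst] at h3
            rw [mem_P0_snd] at hj ⊢
            have : (v : ℕ) < j := hv
            omega
          rw [Evec_inr, Evec_inr]
          simp only [hiff]
    · obtain ⟨j, hj, hj', hmin⟩ := exists_min_diff n _ _
        (hA.trans (card_P0_fst n s i h2).symm) hAe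
      refine ⟨Sum.inl j, ?_, ?_⟩
      · rw [Evec_inl, Evec_inl, if_neg hj', if_pos hj]; exact one_pos
      · rintro (v | v) hv
        · have hv : v < j := by simpa using hv
          have h3 : v ∈ (P0 n s i).1 := by
            rw [mem_P0_fst] at hj ⊢
            have : (v : ℕ) < j := hv
            omega
          rw [Evec_inl, Evec_inl, if_pos h3, if_pos (hmin v hv h3)]
        · simp at hv

end
end

section
/- Suppose k = ℚ. For every m ≥ 0, the degree-m homogeneous component of the invariant subalgebra R^{Σ_n} has ℚ-dimension Σ_{i=0}^{n} Σ_{j=0}^{m} p(i,j)·p(n−i, m−j). -/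
open MvPolynomial

noncomputable section

variable (k : Type) [CommRing k] (n : ℕ)

set_option synthInstance.maxHeartbeats 1000000
set_option maxHeartbeats 1000000

/-- The grading weight: each `w_i` has degree `1` and each `u_i` has degree `0`. -/
def wgt : Fin n ⊕ Fin n → ℕ := Sum.elim (fun _ => 1) (fun _ => 0)

/-- `p(a,b)`: the number of partitions of `b` into at most `a` parts. -/
def pcount (a b : ℕ) : ℕ :=
  Fintype.card {P : Nat.Partition b // Multiset.card P.parts ≤ a}

/-- The degree-`m` homogeneous component of the invariant subalgebra `R^{Σ_n}` over `ℚ`: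
the invariant elements that are images of weighted-homogeneous polynomials of degree `m`
(for the grading `|w_i| = 1`, `|u_i| = 0`; the defining ideal is homogeneous, so this is the
degree-`m` part of the induced grading). -/
def invDeg (m : ℕ) : Submodule ℚ (RR ℚ n) :=
  Subalgebra.toSubmodule (invariants ℚ n) ⊓
    Submodule.map (Ideal.Quotient.mkₐ ℚ (Ideal.span (relSet ℚ n))).toLinearMap
      (weightedHomogeneousSubmodule ℚ (wgt n) m)

/-! ### Counting -/

/-- Multisets of naturals with `a` elements and sum `b`. -/
abbrev MS (a b : ℕ) := {A : Multiset ℕ // Multiset.card A = a ∧ A.sum = b}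

theorem filter_ne_add_replicate (A : Multiset ℕ) :
    A.filter (· ≠ 0) + Multiset.replicate (Multiset.card A - Multiset.card (A.filter (· ≠ 0))) 0
      = A := by
  have h := Multiset.filter_add_not (· ≠ 0) A
  have h2 : A.filter (fun x => ¬ (x ≠ 0)) = Multiset.replicate (A.count 0) 0 := by
    simp only [ne_eq, not_not]
    exact Multiset.filter_eq' A 0
  have h3 := congrArg Multiset.card h
  rw [h2] at h h3
  simp only [Multiset.card_add, Multiset.card_replicate] at h3
  rw [show Multiset.card A - Multiset.card (A.filter (· ≠ 0)) = A.count 0 by omega]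
  exact h

def msEquiv (a b : ℕ) : MS a b ≃ {P : Nat.Partition b // Multiset.card P.parts ≤ a} where
  toFun A := ⟨Nat.Partition.ofSums b A.1 A.2.2, by
    have := A.2.1
    have h := Multiset.card_le_card (Multiset.filter_le (· ≠ 0) A.1)
    simp only [Nat.Partition.ofSums]
    omega⟩
  invFun P := ⟨P.1.parts + Multiset.replicate (a - Multiset.card P.1.parts) 0, by
    have := P.2
    simp only [Multiset.card_add, Multiset.card_replicate]
    omega, by
    simp [P.1.parts_sum]⟩
  left_inv A := by
    apply Subtype.ext
    obtain ⟨A, rfl, h⟩ := A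
    exact filter_ne_add_replicate A
  right_inv P := by
    apply Subtype.ext
    apply Nat.Partition.ext
    simp only [Nat.Partition.ofSums, Multiset.filter_add]
    rw [Multiset.filter_eq_self.2, Multiset.filter_eq_nil.2]
    · simp
    · intro x hx
      simp [Multiset.eq_of_mem_replicate hx]
    · intro x hx
      exact (P.1.parts_pos hx).ne'

instance (a b : ℕ) : Finite (MS a b) := Finite.of_equiv _ (msEquiv a b).symm

theorem card_MS (a b : ℕ) : Nat.card (MS a b) = pcount a b := by
  rw [Nat.card_congr (msEquiv a b), Nat.card_eq_fintype_card, pcount]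

/-- Pairs of multisets. -/
abbrev PS (n m : ℕ) := {p : Multiset ℕ × Multiset ℕ //
  Multiset.card p.1 + Multiset.card p.2 = n ∧ p.1.sum + p.2.sum = m}

def psMap (n m : ℕ) (p : PS n m) : Fin (n + 1) × Fin (m + 1) :=
  (⟨Multiset.card p.1.1, by have := p.2.1; omega⟩, ⟨p.1.1.sum, by have := p.2.2; omega⟩)

def psFiber (n m : ℕ) (y : Fin (n + 1) × Fin (m + 1)) :
    {p : PS n m // psMap n m p = y} ≃ MS y.1 y.2 × MS (n - y.1) (m - y.2) where
  toFun p := (⟨p.1.1.1, by obtain ⟨p, rfl⟩ := p; exact ⟨rfl, rfl⟩⟩, ⟨p.1.1.2, by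
    obtain ⟨p, rfl⟩ := p
    have := p.2
    simp only [psMap]
    omega⟩)
  invFun q := ⟨⟨(q.1.1, q.2.1), by
    have h1 := q.1.2
    have h2 := q.2.2
    have h3 := y.1.2
    have h4 := y.2.2
    simp only
    omega⟩, by
    apply Prod.ext <;> apply Fin.ext
    · exact q.1.2.1
    · exact q.1.2.2⟩
  left_inv p := rfl
  right_inv q := rfl

def psEquiv (n m : ℕ) :
    PS n m ≃ Σ y : Fin (n + 1) × Fin (m + 1), MS y.1 y.2 × MS (n - y.1) (m - y.2) :=
  (Equiv.sigmaFiberEquiv (psMap n m)).symm.trans (Equiv.sigmaCongrRight (psFiber n m))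

instance (n m : ℕ) : Finite (PS n m) := Finite.of_equiv _ (psEquiv n m).symm

theorem card_PS (n m : ℕ) : Nat.card (PS n m) =
    ∑ i ∈ Finset.range (n + 1), ∑ j ∈ Finset.range (m + 1),
            pcount i j * pcount (n - i) (m - j) := by
  rw [Nat.card_congr (psEquiv n m), Nat.card_sigma, Fintype.sum_prod_type, Finset.sum_range]
  refine Finset.sum_congr rfl fun i _ => ?_
  rw [Finset.sum_range]
  refine Finset.sum_congr rfl fun j _ => ?_
  rw [Nat.card_prod, card_MS, card_MS]

/-- Orbits. -/
abbrev OS (n m : ℕ) := {s : Multiset (ℕ × Bool) //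
  Multiset.card s = n ∧ (s.map Prod.fst).sum = m}

theorem split_ms (s : Multiset (ℕ × Bool)) :
    ((s.filter (fun x => x.2 = true)).map Prod.fst).map (fun a => (a, true)) +
    ((s.filter (fun x => ¬ x.2 = true)).map Prod.fst).map (fun a => (a, false)) = s := by
  conv_rhs => rw [← Multiset.filter_add_not (fun x => x.2 = true) s]
  congr 1
  · rw [Multiset.map_map]
    conv_rhs => rw [← Multiset.map_id (Multiset.filter _ s)]
    refine Multiset.map_congr rfl fun x hx => ?_
    have := (Multiset.mem_filter.1 hx).2
    ext <;> simp [this]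
  · rw [Multiset.map_map]
    conv_rhs => rw [← Multiset.map_id (Multiset.filter _ s)]
    refine Multiset.map_congr rfl fun x hx => ?_
    have := (Multiset.mem_filter.1 hx).2
    ext <;> simp_all

def osEquiv (n m : ℕ) : OS n m ≃ PS n m where
  toFun s := ⟨((s.1.filter (fun x => x.2 = true)).map Prod.fst,
      (s.1.filter (fun x => ¬ x.2 = true)).map Prod.fst), by
    have h := split_ms s.1
    have h1 := congrArg Multiset.card h
    have h2 := congrArg (fun t => (Multiset.map Prod.fst t).sum) h
    rw [s.2.1] at h1
    simp only [s.2.2] at h2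
    simp only [Multiset.map_add, Multiset.sum_add, Multiset.map_map, Function.comp_def] at h2
    simp only [Multiset.card_add, Multiset.card_map] at h1 ⊢
    exact ⟨h1, h2⟩⟩
  invFun p := ⟨p.1.1.map (fun a => (a, true)) + p.1.2.map (fun a => (a, false)), by
    simpa [Multiset.map_map, Function.comp_def] using p.2⟩
  left_inv s := Subtype.ext (split_ms s.1)
  right_inv p := by
    apply Subtype.ext
    simp [Multiset.filter_map, Multiset.map_map]

instance (n m : ℕ) : Finite (OS n m) := Finite.of_equiv _ (osEquiv n m).symm

/-! ### Normal form -/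

abbrev GG (n : ℕ) := Fin n → ℕ × Bool

def qq {n : ℕ} (g : GG n) : Multiset (ℕ × Bool) := (Finset.univ : Finset (Fin n)).val.map g

theorem qq_surj (n : ℕ) (s : Multiset (ℕ × Bool)) (h : Multiset.card s = n) :
    ∃ g : GG n, qq g = s := by
  induction s using Quotient.inductionOn with
  | h l =>
    have h : l.length = n := h
    subst h
    refine ⟨l.get, ?_⟩
    rw [qq, Fin.univ_val_map, List.ofFn_get]
    rfl

theorem qq_comp {n : ℕ} (g : GG n) (σ : Equiv.Perm (Fin n)) : qq (g ∘ σ) = qq g := by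
  rw [qq, ← Multiset.map_map, Multiset.map_univ_val_equiv]
  rfl

theorem qq_inj {n : ℕ} (g g' : GG n) (h : qq g = qq g') :
    ∃ σ : Equiv.Perm (Fin n), g' ∘ σ = g := by
  have key : ∀ c, Nonempty ({a // g a = c} ≃ {a // g' a = c}) := by
    intro c
    have h1 := congrArg (Multiset.count c) h
    simp only [qq, Multiset.count_map] at h1
    refine ⟨Fintype.equivOfCardEq ?_⟩
    rw [Fintype.card_subtype, Fintype.card_subtype]
    simp only [eq_comm (a := c)] at h1
    exact h1
  have e := fun c => (key c).some
  exact ⟨Equiv.ofFiberEquiv e, funext fun a => Equiv.ofFiberEquiv_map e a⟩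

def nu {n : ℕ} (d : Fin n ⊕ Fin n →₀ ℕ) : GG n :=
  fun i => (d (Sum.inl i), decide (d (Sum.inr i) ≠ 0))

def lft {n : ℕ} (g : GG n) : Fin n ⊕ Fin n →₀ ℕ :=
  Finsupp.equivFunOnFinite.symm (Sum.elim (fun i => (g i).1) (fun i => if (g i).2 then 1 else 0))

theorem nu_lft {n : ℕ} (g : GG n) : nu (lft g) = g := by
  funext i
  ext <;> simp [nu, lft]

def gdeg {n : ℕ} (g : GG n) : ℕ := ∑ i, (g i).1

theorem gdeg_qq {n : ℕ} (g : GG n) : ((qq g).map Prod.fst).sum = gdeg g := by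
  rw [qq, Multiset.map_map]; rfl

theorem weight_eq {n : ℕ} (d : Fin n ⊕ Fin n →₀ ℕ) :
    Finsupp.weight (wgt n) d = gdeg (nu d) := by
  rw [Finsupp.weight_apply, Finsupp.sum_fintype _ _ (by simp)]
  simp [wgt, gdeg, nu]

/-- Normal form map. -/
def NN (n : ℕ) : MvPolynomial (Fin n ⊕ Fin n) ℚ →ₗ[ℚ] (GG n →₀ ℚ) :=
  (MvPolynomial.basisMonomials (Fin n ⊕ Fin n) ℚ).constr ℚ (fun d => Finsupp.single (nu d) 1)

theorem NN_monomial {n : ℕ} (d : Fin n ⊕ Fin n →₀ ℕ) (c : ℚ) :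
    NN n (monomial d c) = Finsupp.single (nu d) c := by
  have h : monomial d c = c • (MvPolynomial.basisMonomials (Fin n ⊕ Fin n) ℚ) d := by
    simp [MvPolynomial.coe_basisMonomials, MvPolynomial.smul_monomial]
  rw [h, map_smul, NN, Module.Basis.constr_basis]
  simp

theorem NN_gen {n : ℕ} (i : Fin n) (a : MvPolynomial (Fin n ⊕ Fin n) ℚ) :
    NN n (a * (X (Sum.inr i) ^ 2 - X (Sum.inr i))) = 0 := by
  induction a using MvPolynomial.induction_on' with
  | monomial d c =>
    rw [mul_sub, map_sub, X_pow_eq_monomial, X, monomial_mul, monomial_mul, NN_monomial,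
      NN_monomial, sub_eq_zero]
    congr 1
    funext j
    by_cases h : i = j <;> simp [nu, Finsupp.single_apply, h]
  | add p q hp hq => rw [add_mul, map_add, hp, hq, add_zero]

theorem NN_ideal {n : ℕ} (x : MvPolynomial (Fin n ⊕ Fin n) ℚ)
    (hx : x ∈ Ideal.span (relSet ℚ n)) : NN n x = 0 := by
  suffices h : ∀ a, NN n (a * x) = 0 by simpa using h 1
  induction hx using Submodule.span_induction with
  | zero => simp
  | add x y _ _ hx hy => intro a; rw [mul_add, map_add, hx, hy, add_zero]
  | mem x h =>
    obtain ⟨i, rfl⟩ := h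
    exact NN_gen i
  | smul b x _ hx => intro a; rw [smul_eq_mul, ← mul_assoc]; exact hx _

abbrev mkR (n : ℕ) : MvPolynomial (Fin n ⊕ Fin n) ℚ →ₐ[ℚ] RR ℚ n :=
  Ideal.Quotient.mkₐ ℚ (Ideal.span (relSet ℚ n))

theorem mk_monomial {n : ℕ} (d : Fin n ⊕ Fin n →₀ ℕ) :
    mkR n (monomial d 1) = mkR n (monomial (lft (nu d)) 1) := by
  have hu : ∀ i : Fin n, IsIdempotentElem (mkR n (X (Sum.inr i))) := by
    intro i
    rw [IsIdempotentElem, ← map_mul, ← sub_eq_zero, ← map_sub]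
    refine Ideal.Quotient.eq_zero_iff_mem.2 (Ideal.subset_span ⟨i, ?_⟩)
    simp [pow_two]
  rw [monomial_eq, monomial_eq, Finsupp.prod_fintype _ _ (by simp),
    Finsupp.prod_fintype _ _ (by simp), Fintype.prod_sum_type, Fintype.prod_sum_type]
  simp only [map_mul, map_prod, map_pow, map_one]
  congr 2
  · refine Finset.prod_congr rfl fun i _ => ?_
    rcases h : d (Sum.inr i) with _ | k
    · simp [lft, nu, h]
    · rw [(hu i).pow_succ_eq]
      simp [lft, nu, h]

def SS (n : ℕ) : (GG n →₀ ℚ) →ₗ[ℚ] RR ℚ n :=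
  Finsupp.linearCombination ℚ (fun g => mkR n (monomial (lft g) 1))

theorem SS_single {n : ℕ} (g : GG n) (c : ℚ) :
    SS n (Finsupp.single g c) = mkR n (monomial (lft g) c) := by
  rw [SS, Finsupp.linearCombination_single, ← map_smul, smul_monomial]
  simp

def TT (n : ℕ) : RR ℚ n →ₗ[ℚ] (GG n →₀ ℚ) :=
  Submodule.liftQ ((Ideal.span (relSet ℚ n)).restrictScalars ℚ) (NN n)
    (fun x hx => NN_ideal x hx)

theorem TT_mk {n : ℕ} (x : MvPolynomial (Fin n ⊕ Fin n) ℚ) : TT n (mkR n x) = NN n x := rfl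

theorem SS_NN {n : ℕ} (x : MvPolynomial (Fin n ⊕ Fin n) ℚ) : SS n (NN n x) = mkR n x := by
  induction x using MvPolynomial.induction_on' with
  | monomial d c =>
    have h : ∀ d : Fin n ⊕ Fin n →₀ ℕ, monomial d c = c • monomial d (1 : ℚ) := by
      simp [smul_monomial]
    rw [NN_monomial, SS_single, h, h, map_smul, map_smul, ← mk_monomial]
  | add p q hp hq => rw [map_add, map_add, map_add, hp, hq]

def ee (n : ℕ) : RR ℚ n ≃ₗ[ℚ] (GG n →₀ ℚ) :=
  LinearEquiv.ofLinear (TT n) (SS n)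
    (by
      ext g : 1
      apply LinearMap.ext
      intro c
      simp only [LinearMap.comp_apply, Finsupp.lsingle_apply, SS_single, TT_mk, NN_monomial,
        nu_lft, LinearMap.id_apply])
    (by
      apply LinearMap.ext
      intro x
      obtain ⟨x, rfl⟩ := Ideal.Quotient.mkₐ_surjective ℚ (Ideal.span (relSet ℚ n)) x
      exact SS_NN x)

theorem ee_mk {n : ℕ} (x : MvPolynomial (Fin n ⊕ Fin n) ℚ) : ee n (mkR n x) = NN n x := rfl

theorem ee_symm_single {n : ℕ} (g : GG n) (c : ℚ) :
    (ee n).symm (Finsupp.single g c) = mkR n (monomial (lft g) c) := SS_single g c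

theorem perm_mk {n : ℕ} (σ : Equiv.Perm (Fin n)) (x : MvPolynomial (Fin n ⊕ Fin n) ℚ) :
    permAut ℚ n σ (mkR n x) = mkR n (rename (Sum.map σ σ) x) := rfl

theorem NN_rename {n : ℕ} (σ : Equiv.Perm (Fin n)) (x : MvPolynomial (Fin n ⊕ Fin n) ℚ)
    (g : GG n) : NN n (rename (Sum.map σ σ) x) g = NN n x (g ∘ σ) := by
  induction x using MvPolynomial.induction_on' with
  | monomial d c =>
    rw [rename_monomial, NN_monomial, NN_monomial, Finsupp.single_apply, Finsupp.single_apply]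
    have hinj : Function.Injective (Sum.map σ σ) := Sum.map_injective.2 ⟨σ.injective, σ.injective⟩
    have h1 : ∀ i, nu (Finsupp.mapDomain (Sum.map σ σ) d) (σ i) = nu d i := by
      intro i
      have h1 := Finsupp.mapDomain_apply hinj d (Sum.inl i)
      have h2 := Finsupp.mapDomain_apply hinj d (Sum.inr i)
      simp only [Sum.map_inl, Sum.map_inr] at h1 h2
      simp [nu, h1, h2]
    refine if_congr ?_ rfl rfl
    constructor
    · rintro rfl
      funext i
      exact (h1 i).symm
    · intro h
      funext i
      obtain ⟨i, rfl⟩ := σ.surjective i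
      rw [h1, h]
      rfl
  | add p q hp hq => simp only [map_add, Finsupp.add_apply, hp, hq]

theorem ee_perm {n : ℕ} (σ : Equiv.Perm (Fin n)) (x : RR ℚ n) (g : GG n) :
    ee n (permAut ℚ n σ x) g = ee n x (g ∘ σ) := by
  obtain ⟨x, rfl⟩ := Ideal.Quotient.mkₐ_surjective ℚ (Ideal.span (relSet ℚ n)) x
  exact NN_rename σ x g

theorem mem_hom {n m : ℕ} (x : RR ℚ n) :
    x ∈ Submodule.map (mkR n).toLinearMap (weightedHomogeneousSubmodule ℚ (wgt n) m) ↔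
      ∀ g, ee n x g ≠ 0 → gdeg g = m := by
  constructor
  · rintro ⟨p, hp, rfl⟩ g hg
    change NN n p g ≠ 0 at hg
    rw [p.as_sum, map_sum, Finsupp.finset_sum_apply] at hg
    obtain ⟨d, hd, h⟩ := Finset.exists_ne_zero_of_sum_ne_zero hg
    rw [NN_monomial, Finsupp.single_apply] at h
    obtain ⟨h1, h2⟩ : nu d = g ∧ coeff d p ≠ 0 := by simpa using h
    rw [← h1, ← weight_eq]
    exact hp h2
  · intro h
    rw [← (ee n).symm_apply_apply x, ← Finsupp.sum_single (ee n x), Finsupp.sum, map_sum]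
    refine Submodule.sum_mem _ fun g hg => ?_
    rw [ee_symm_single]
    refine Submodule.mem_map_of_mem ?_
    rw [mem_weightedHomogeneousSubmodule]
    apply isWeightedHomogeneous_monomial
    rw [weight_eq, nu_lft]
    exact h g (Finsupp.mem_support_iff.1 hg)

theorem mem_invDeg {n m : ℕ} (x : RR ℚ n) :
    x ∈ invDeg n m ↔ (∀ (σ : Equiv.Perm (Fin n)) (g : GG n), ee n x (g ∘ σ) = ee n x g) ∧
      ∀ g, ee n x g ≠ 0 → gdeg g = m := by
  rw [invDeg, Submodule.mem_inf, ← mem_hom]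
  refine and_congr ?_ Iff.rfl
  change (∀ σ : Equiv.Perm (Fin n), permAut ℚ n σ x = x) ↔ _
  refine forall_congr' fun σ => ?_
  rw [← (ee n).injective.eq_iff, Finsupp.ext_iff]
  simp only [ee_perm]

theorem finite_deg (n m : ℕ) : {g : GG n | gdeg g = m}.Finite := by
  refine (Set.Finite.pi' (t := fun _ : Fin n => Set.Iic m ×ˢ (Set.univ : Set Bool))
    fun _ => (Set.finite_Iic m).prod Set.finite_univ).subset ?_
  intro g hg i
  refine ⟨?_, Set.mem_univ _⟩
  rw [← (show gdeg g = m from hg)]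
  exact Finset.single_le_sum (f := fun i => (g i).1) (fun _ _ => Nat.zero_le _) (Finset.mem_univ i)

def rep {n m : ℕ} (s : OS n m) : GG n := (qq_surj n s.1 s.2.1).choose

theorem qq_rep {n m : ℕ} (s : OS n m) : qq (rep s) = s.1 := (qq_surj n s.1 s.2.1).choose_spec

theorem card_qq {n : ℕ} (g : GG n) : Multiset.card (qq g) = n := by simp [qq]

def AA (n m : ℕ) : invDeg n m →ₗ[ℚ] (OS n m → ℚ) where
  toFun x s := ee n x.1 (rep s)
  map_add' x y := by funext s; simp
  map_smul' c x := by funext s; simp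

theorem AA_inj (n m : ℕ) : Function.Injective (AA n m) := by
  rw [← LinearMap.ker_eq_bot, LinearMap.ker_eq_bot']
  intro x hx
  apply Subtype.ext
  apply (ee n).injective
  obtain ⟨h1, h2⟩ := (mem_invDeg x.1).1 x.2
  ext g
  rw [Submodule.coe_zero, map_zero, Finsupp.zero_apply]
  by_contra hg
  have hd := h2 g hg
  let s : OS n m := ⟨qq g, card_qq g, by rw [gdeg_qq, hd]⟩
  obtain ⟨σ, hσ⟩ := qq_inj g (rep s) (qq_rep s).symm
  apply hg
  rw [← hσ, h1]
  exact congrFun hx s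

theorem AA_surj (n m : ℕ) : Function.Surjective (AA n m) := by
  classical
  intro h
  let F : GG n → ℚ := fun g =>
    if hg : Multiset.card (qq g) = n ∧ ((qq g).map Prod.fst).sum = m then h ⟨qq g, hg⟩ else 0
  have hF0 : ∀ g, F g ≠ 0 → gdeg g = m := by
    intro g hg
    by_contra hc
    apply hg
    have : ¬ (Multiset.card (qq g) = n ∧ ((qq g).map Prod.fst).sum = m) := by
      rw [gdeg_qq]; tauto
    simp only [F]
    rw [dif_neg this]
  have hFq : ∀ g g', qq g = qq g' → F g = F g' := by
    intro g g' hgg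
    simp only [F, hgg]
  let f : GG n →₀ ℚ := Finsupp.ofSupportFinite F ((finite_deg n m).subset hF0)
  have hf : ∀ g, f g = F g := fun g => rfl
  refine ⟨⟨(ee n).symm f, (mem_invDeg _).2 ?_⟩, ?_⟩
  · rw [LinearEquiv.apply_symm_apply]
    exact ⟨fun σ g => hFq _ _ (qq_comp g σ), hF0⟩
  · funext s
    change ee n ((ee n).symm f) (rep s) = h s
    rw [LinearEquiv.apply_symm_apply, hf]
    have hs : Multiset.card (qq (rep s)) = n ∧ ((qq (rep s)).map Prod.fst).sum = m := by
      rw [qq_rep]; exact s.2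
    simp only [F]
    rw [dif_pos hs]
    congr 1
    exact Subtype.ext (qq_rep s)

/-- for `k = ℚ`, the degree-`m` homogeneous component of `R^{Σ_n}` has
`ℚ`-dimension `Σ_{i=0}^{n} Σ_{j=0}^{m} p(i,j)·p(n−i, m−j)`. -/
theorem finrank_invDeg (hn : 0 < n) (m : ℕ) :
    FiniteDimensional ℚ (invDeg n m) ∧
      Module.finrank ℚ (invDeg n m)
        = ∑ i ∈ Finset.range (n + 1), ∑ j ∈ Finset.range (m + 1),
            pcount i j * pcount (n - i) (m - j) := by
  have e := LinearEquiv.ofBijective (AA n m) ⟨AA_inj n m, AA_surj n m⟩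
  have := Fintype.ofFinite (OS n m)
  refine ⟨Module.Finite.equiv e.symm, ?_⟩
  rw [e.finrank_eq, Module.finrank_fintype_fun_eq_card, ← Nat.card_eq_fintype_card,
    Nat.card_congr (osEquiv n m), card_PS]

end
end
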